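/- arXiv:1902.03316 — 12 statements merged into one kernel-verified Lean document; each statement's English description precedes it below -/
import Mathlib

section
/- (Weighted matrix-tree identity.) Let G be a connected finite simple graph on {1,…,p} with p ≥ 2, let γ ∈ {0,1}^E and v0, v1 ∈ (0,∞), and let L_γ be the weighted Laplacian with edge weights v0⁻¹γ_e + v1⁻¹(1−γ_e). Let w ∈ ℝ^p with 1_pᵀw ≠ 0 and let V ∈ ℝ^{p×(p−1)} have orthonormal columns with Vᵀw = 0. Then det(VᵀL_γV) = ((1_pᵀw)² / ‖w‖²) · Σ_{T ∈ spt(G)} Π_{(i,j)∈T} [v0⁻¹γ_{ij} + v1⁻¹(1−γ_{ij})]. -/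
open Matrix BigOperators Finset
open scoped Classical

noncomputable section

/-- The simple graph on `Fin p` with edge set `E` (pairs listed with `i < j`). -/
def graphOf {p : ℕ} (E : Finset (Fin p × Fin p)) : SimpleGraph (Fin p) :=
  SimpleGraph.fromRel (fun i j => (i, j) ∈ E)

/-- The set of spanning trees of the graph with edge set `E`: subsets `T ⊆ E` with
`|T| = p - 1` such that `(V, T)` is connected. -/
def spanningTrees {p : ℕ} (E : Finset (Fin p × Fin p)) : Finset (Finset (Fin p × Fin p)) :=
  E.powerset.filter (fun T => T.card = p - 1 ∧ (graphOf T).Connected)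

/-- A single edge incidence vector `e_i - e_j` for the edge `e = (i,j)`. -/
def edgeVec {p : ℕ} (e : Fin p × Fin p) : Fin p → ℝ :=
  fun i => (if i = e.1 then (1 : ℝ) else 0) - (if i = e.2 then 1 else 0)

/-- The weighted graph Laplacian `L(c) = Dᵀ diag(c) D`. -/
def wlap {p : ℕ} (E : Finset (Fin p × Fin p)) (c : Fin p × Fin p → ℝ) :
    Matrix (Fin p) (Fin p) ℝ :=
  ∑ e ∈ E, c e • Matrix.vecMulVec (edgeVec e) (edgeVec e)

/-- The weighted Gram matrix of a family of vectors, expanded by multilinearity of the determinant;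
only injective choices of one vector per row contribute. -/
lemma det_sum_smul_vecMulVec {ι n : Type*} [DecidableEq ι] [Fintype n] [DecidableEq n]
    (E : Finset ι) (c : ι → ℝ) (u : ι → n → ℝ) :
    (∑ e ∈ E, c e • vecMulVec (u e) (u e)).det =
      ∑ r ∈ Fintype.piFinset (fun _ : n => E) with Function.Injective r,
        (∏ i, c (r i)) * ((∏ i, u (r i) i) * det (fun i => u (r i))) := by
  have hrow : (∑ e ∈ E, c e • vecMulVec (u e) (u e)) =
      fun i => ∑ e ∈ E, (c e * u e i) • u e := by
    ext i j
    simp [Matrix.sum_apply, vecMulVec_apply, mul_assoc]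
  have hexp := (detRowAlternating (n := n) (R := ℝ)).toMultilinearMap.map_sum_finset
    (fun i e => (c e * u e i) • u e) (fun _ => E)
  rw [hrow]
  refine hexp.trans ?_
  rw [Finset.sum_filter]
  refine Finset.sum_congr rfl fun r _ => ?_
  rw [MultilinearMap.map_smul_univ]
  split_ifs with hr
  · simp only [Finset.prod_mul_distrib, smul_eq_mul, mul_assoc]
    rfl
  · obtain ⟨i, j, hij, hne⟩ := Function.not_injective_iff.mp hr
    have h0 : (detRowAlternating (n := n) (R := ℝ)) (fun i => u (r i)) = 0 :=
      AlternatingMap.map_eq_zero_of_eq _ _ (congrArg u hij) hne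
    exact (congrArg _ h0).trans (smul_zero _)

/-- The Cauchy–Binet formula for weighted Gram matrices. -/
lemma det_sum_smul_vecMulVec_eq_sum_powersetCard {ι n : Type*} [DecidableEq ι] [Fintype n]
    [DecidableEq n] (E : Finset ι) (c : ι → ℝ) (u : ι → n → ℝ) :
    (∑ e ∈ E, c e • vecMulVec (u e) (u e)).det =
      ∑ T ∈ E.powersetCard (Fintype.card n),
        (∏ e ∈ T, c e) * (∑ e ∈ T, vecMulVec (u e) (u e)).det := by
  rw [det_sum_smul_vecMulVec]
  have hmaps : ∀ r ∈ {r ∈ Fintype.piFinset (fun _ : n => E) | Function.Injective r},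
      Finset.univ.image r ∈ E.powersetCard (Fintype.card n) := by
    intro r hr
    rw [Finset.mem_filter, Fintype.mem_piFinset] at hr
    rw [Finset.mem_powersetCard, Finset.card_image_of_injective _ hr.2, Finset.card_univ]
    exact ⟨Finset.image_subset_iff.mpr fun i _ => hr.1 i, rfl⟩
  rw [← Finset.sum_fiberwise_of_maps_to hmaps]
  refine Finset.sum_congr rfl fun T hT => ?_
  rw [Finset.mem_powersetCard] at hT
  have hgram := det_sum_smul_vecMulVec T (fun _ => (1 : ℝ)) u
  simp only [one_smul, Finset.prod_const_one, one_mul] at hgram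
  rw [hgram, Finset.mul_sum]
  refine Finset.sum_congr ?_ fun r hr => ?_
  · ext r
    simp only [Finset.mem_filter, Fintype.mem_piFinset]
    constructor
    · rintro ⟨⟨-, hinj⟩, rfl⟩
      exact ⟨fun i => Finset.mem_image_of_mem _ (Finset.mem_univ i), hinj⟩
    · rintro ⟨hmem, hinj⟩
      refine ⟨⟨fun i => hT.1 (hmem i), hinj⟩, ?_⟩
      refine Finset.eq_of_subset_of_card_le (Finset.image_subset_iff.mpr fun i _ => hmem i) ?_
      rw [Finset.card_image_of_injective _ hinj, Finset.card_univ, hT.2]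
  · rw [Finset.mem_filter, Fintype.mem_piFinset] at hr
    have himg : Finset.univ.image r = T := by
      refine Finset.eq_of_subset_of_card_le (Finset.image_subset_iff.mpr fun i _ => hr.1 i) ?_
      rw [Finset.card_image_of_injective _ hr.2, Finset.card_univ, hT.2]
    rw [← himg, Finset.prod_image hr.2.injOn]

/-- The determinant of the differences to the last row of a matrix whose orthonormal columns are
orthogonal to `w`. -/
lemma det_row_sub_sq {n : Type*} [Fintype n] [DecidableEq n] (V : Matrix (n ⊕ Unit) n ℝ)
    (w : n ⊕ Unit → ℝ) (hw : ∑ i, w i ≠ 0) (hV : Vᵀ * V = 1) (hVw : Vᵀ *ᵥ w = 0) :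
    (of fun i j => V (Sum.inl i) j - V (Sum.inr ()) j).det ^ 2 =
      (∑ i, w i) ^ 2 / ∑ i, w i ^ 2 := by
  set D : Matrix n n ℝ := of fun i j => V (Sum.inl i) j - V (Sum.inr ()) j with hD
  set s := ∑ i, w i with hs
  have hVV : ∀ j k, ∑ i, V i j * V i k = if j = k then 1 else 0 := by
    intro j k
    simpa [mul_apply, one_apply] using congrFun (congrFun hV j) k
  have hVw' : ∀ j, ∑ i, V i j * w i = 0 := by
    intro j
    simpa [mulVec, dotProduct] using congrFun hVw j
  let A : Matrix (n ⊕ Unit) (n ⊕ Unit) ℝ :=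
    fromBlocks 1 (of fun _ _ => -1) (of fun _ j => w (Sum.inl j)) (of fun _ _ => w (Sum.inr ()))
  let C : Matrix (n ⊕ Unit) (n ⊕ Unit) ℝ := fromCols V (of fun _ _ => 1)
  let W : Matrix (n ⊕ Unit) (n ⊕ Unit) ℝ := fromCols V (of fun i _ => w i)
  have hA : A.det = s := by
    simp only [A, det_fromBlocks_one₁₁, det_unique, hs]
    simp [mul_apply, add_comm]
  have hAC : A * C = fromBlocks D 0 0 (of fun _ _ => s) := by
    ext (i | i) (j | j)
    · simp [A, C, mul_apply, hD, one_apply, sub_eq_add_neg]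
    · simp [A, C, mul_apply, one_apply]
    · have h := hVw' j
      simp only [Fintype.sum_sum_type] at h
      simp [A, C, mul_apply, mul_comm] at h ⊢
      exact h
    · simp [A, C, mul_apply, hs]
  have hWC : Wᵀ * C = fromBlocks 1 (of fun j _ => ∑ i, V i j) 0 (of fun _ _ => s) := by
    ext (i | i) (j | j)
    · have h := hVV i j
      simp only [Fintype.sum_sum_type] at h
      simpa [W, C, mul_apply, one_apply] using h
    · simp [W, C, mul_apply]
    · have h := hVw' j
      simp only [Fintype.sum_sum_type] at h
      simp [W, C, mul_apply, mul_comm] at h ⊢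
      exact h
    · simp [W, C, mul_apply, hs]
  have hWW : Wᵀ * W = fromBlocks 1 0 0 (of fun _ _ => ∑ i, w i ^ 2) := by
    ext (i | i) (j | j)
    · have h := hVV i j
      simp only [Fintype.sum_sum_type] at h
      simpa [W, mul_apply, one_apply] using h
    · have h := hVw' i
      simp only [Fintype.sum_sum_type] at h
      simpa [W, mul_apply] using h
    · have h := hVw' j
      simp only [Fintype.sum_sum_type] at h
      simp [W, mul_apply, mul_comm] at h ⊢
      exact h
    · simp [W, mul_apply, sq]
  have h1 : s * C.det = D.det * s := by
    have h := congrArg det hAC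
    rw [det_mul, hA, det_fromBlocks_zero₂₁] at h
    simpa using h
  have h2 : W.det * C.det = s := by
    have h := congrArg det hWC
    rw [det_mul, det_transpose, det_fromBlocks_zero₂₁] at h
    simpa using h
  have h3 : W.det * W.det = ∑ i, w i ^ 2 := by
    have h := congrArg det hWW
    rw [det_mul, det_transpose, det_fromBlocks_zero₂₁] at h
    simpa using h
  have hDC : D.det = C.det := mul_right_cancel₀ hw (by rw [← h1, mul_comm])
  have hW : W.det ≠ 0 := fun h0 => hw (by rw [← h2, h0, zero_mul])
  rw [← h3, hDC, ← h2]
  field_simp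

/-- The integer incidence matrix of a family of oriented edges on `Fin (n + 1)`, with the column
of vertex `0` deleted. -/
def reducedIncidence {n : ℕ} {ι : Type*} (b : ι → Fin (n + 1) × Fin (n + 1)) :
    Matrix ι (Fin n) ℤ :=
  of fun i k => (if k.succ = (b i).1 then 1 else 0) - (if k.succ = (b i).2 then 1 else 0)

/-- Applying the reduced incidence matrix to a function vanishing at vertex `0` takes differences
along edges. -/
lemma sum_reducedIncidence_mul {R : Type*} [CommRing R] {n : ℕ} {ι : Type*}
    (b : ι → Fin (n + 1) × Fin (n + 1)) (f : Fin (n + 1) → R) (hf : f 0 = 0) (i : ι) :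
    ∑ k : Fin n, (reducedIncidence b i k : R) * f k.succ = f (b i).1 - f (b i).2 := by
  have key : ∀ a : Fin (n + 1), ∑ k : Fin n, (if k.succ = a then f k.succ else 0) = f a := by
    intro a
    have h := Fin.sum_univ_succ fun k : Fin (n + 1) => if k = a then f k else 0
    simpa [hf] using h.symm
  rw [← key (b i).1, ← key (b i).2, ← Finset.sum_sub_distrib]
  refine Finset.sum_congr rfl fun k _ => ?_
  simp [reducedIncidence, sub_mul]

lemma graphOf_adj {p : ℕ} {T : Finset (Fin p × Fin p)} {a b : Fin p} :
    (graphOf T).Adj a b ↔ a ≠ b ∧ ((a, b) ∈ T ∨ (b, a) ∈ T) :=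
  SimpleGraph.fromRel_adj _ _ _

/-- The reduced incidence matrix of a connected graph with `n` edges on `n + 1` vertices is
unimodular. -/
lemma det_reducedIncidence_sq_of_connected {n : ℕ} {T : Finset (Fin (n + 1) × Fin (n + 1))}
    (σ : Fin n ≃ T) (hT : (graphOf T).Connected) :
    (reducedIncidence fun i => (σ i : Fin (n + 1) × Fin (n + 1))).det ^ 2 = 1 := by
  set Q := reducedIncidence fun i => (σ i : Fin (n + 1) × Fin (n + 1)) with hQ
  let δ : Fin (n + 1) → Fin n → ℤ := fun a k => if k.succ = a then 1 else 0
  have hedge : ∀ e ∈ T, δ e.1 - δ e.2 ∈ LinearMap.range Q.vecMulLinear := by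
    intro e he
    refine ⟨Pi.single (σ.symm ⟨e, he⟩) 1, ?_⟩
    ext k
    simp [hQ, reducedIncidence, δ]
  have hadj : ∀ a b, (graphOf T).Adj a b → δ a - δ b ∈ LinearMap.range Q.vecMulLinear := by
    intro a b hab
    rcases (graphOf_adj.mp hab).2 with h | h
    · exact hedge _ h
    · rw [← neg_sub]
      exact neg_mem (hedge _ h)
  have hwalk : ∀ a b, (graphOf T).Walk a b → δ a - δ b ∈ LinearMap.range Q.vecMulLinear := by
    intro a b q
    induction q with
    | nil => simp
    | cons h _ ih =>
      rw [← sub_add_sub_cancel]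
      exact add_mem (hadj _ _ h) ih
  have hrow : ∀ k : Fin n, ∃ y : Fin n → ℤ, y ᵥ* Q = Pi.single k 1 := by
    intro k
    obtain ⟨q⟩ := hT.preconnected k.succ 0
    obtain ⟨y, hy⟩ := hwalk _ _ q
    refine ⟨y, hy.trans ?_⟩
    ext l
    simp [δ, Pi.single_apply]
  choose P hP using hrow
  have hPQ : of P * Q = 1 := by
    ext i j
    refine (congrFun (hP i) j).trans ?_
    simp only [one_apply, Pi.single_apply, eq_comm]
  have hdet : (of P).det * Q.det = 1 := by rw [← det_mul, hPQ, det_one]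
  exact Int.isUnit_sq (IsUnit.of_mul_eq_one_right _ hdet)

/-- The reduced incidence matrix of a disconnected graph with `n` edges on `n + 1` vertices is
singular. -/
lemma det_reducedIncidence_of_not_connected {n : ℕ} {T : Finset (Fin (n + 1) × Fin (n + 1))}
    (σ : Fin n ≃ T) (hT : ¬ (graphOf T).Connected) :
    (reducedIncidence fun i => (σ i : Fin (n + 1) × Fin (n + 1))).det = 0 := by
  obtain ⟨v, hv⟩ : ∃ v, ¬ (graphOf T).Reachable 0 v := by
    by_contra! h
    exact hT ((SimpleGraph.connected_iff_exists_forall_reachable _).mpr ⟨0, h⟩)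
  let f : Fin (n + 1) → ℤ := fun a => if (graphOf T).Reachable 0 a then 0 else 1
  have hf : f 0 = 0 := by simp [f]
  have hedge : ∀ e ∈ T, f e.1 = f e.2 := by
    rintro ⟨a, b⟩ he
    by_cases hab : a = b
    · rw [hab]
    · have hr : (graphOf T).Reachable a b :=
        (graphOf_adj.mpr ⟨hab, Or.inl he⟩ : (graphOf T).Adj a b).reachable
      have : (graphOf T).Reachable 0 a ↔ (graphOf T).Reachable 0 b :=
        ⟨fun h => h.trans hr, fun h => h.trans hr.symm⟩
      simp [f, this]
  refine exists_mulVec_eq_zero_iff.mp ⟨fun k => f k.succ, fun h0 => ?_, ?_⟩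
  · obtain rfl | ⟨k, rfl⟩ := v.eq_zero_or_eq_succ
    · exact hv (SimpleGraph.Reachable.refl _)
    · simpa [f, hv] using congrFun h0 k
  · ext i
    have h := sum_reducedIncidence_mul (fun i => (σ i : Fin (n + 1) × Fin (n + 1))) f hf i
    rw [hedge _ (σ i).2, sub_self] at h
    simpa [mulVec, dotProduct] using h

/-- Compressing `∑ e ∈ T, b_e b_eᵀ` to the orthogonal complement of `w`, for `n` edges on `n + 1`
vertices. -/
lemma det_sum_vecMulVec_edgeVec {n : ℕ} (T : Finset (Fin (n + 1) × Fin (n + 1)))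
    (hT : T.card = n) (w : Fin (n + 1) → ℝ) (hw : ∑ i, w i ≠ 0)
    (V : Matrix (Fin (n + 1)) (Fin n) ℝ) (hV : Vᵀ * V = 1) (hVw : Vᵀ *ᵥ w = 0) :
    (∑ e ∈ T, vecMulVec (edgeVec e ᵥ* V) (edgeVec e ᵥ* V)).det =
      if (graphOf T).Connected then (∑ i, w i) ^ 2 / ∑ i, w i ^ 2 else 0 := by
  let σ : Fin n ≃ T := (finCongr hT.symm).trans T.equivFin.symm
  let b : Fin n → Fin (n + 1) × Fin (n + 1) := fun i => σ i
  let D : Matrix (Fin n) (Fin n) ℝ := of fun i j => V i.succ j - V 0 j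
  let Q := reducedIncidence b
  have hD : D.det ^ 2 = (∑ i, w i) ^ 2 / ∑ i, w i ^ 2 := by
    let τ : Fin n ⊕ Unit ≃ Fin (n + 1) :=
      (Equiv.optionEquivSumPUnit (Fin n)).symm.trans (finSuccEquiv n).symm
    have hinl : ∀ i, τ (Sum.inl i) = i.succ := fun i => by simp [τ]
    have hinr : τ (Sum.inr ()) = 0 := by simp [τ]
    have h := det_row_sub_sq (V.submatrix τ id) (w ∘ τ)
      (by simpa [τ.sum_comp] using hw)
      (by
        rw [← hV, transpose_submatrix]
        exact submatrix_mul_equiv _ _ _ τ _)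
      (by
        rw [← hVw]
        ext j
        exact τ.sum_comp fun i => V i j * w i)
    simpa only [submatrix_apply, id, hinl, hinr, Function.comp_apply, τ.sum_comp,
      τ.sum_comp fun i => w i ^ 2] using h
  have hBV : ∀ e : Fin (n + 1) × Fin (n + 1), edgeVec e ᵥ* V = fun j => V e.1 j - V e.2 j := by
    intro e
    ext j
    simp [vecMul, dotProduct, edgeVec, sub_mul]
  have hfac : (of fun i => edgeVec (b i) ᵥ* V) = Q.map (Int.castRingHom ℝ) * D := by
    ext i j
    have h := sum_reducedIncidence_mul b (fun a => V a j - V 0 j) (sub_self _) i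
    rw [sub_sub_sub_cancel_right] at h
    rw [of_apply, hBV, mul_apply]
    exact h.symm
  have hgram : (∑ e ∈ T, vecMulVec (edgeVec e ᵥ* V) (edgeVec e ᵥ* V)) =
      (of fun i => edgeVec (b i) ᵥ* V)ᵀ * of fun i => edgeVec (b i) ᵥ* V := by
    ext j k
    rw [Matrix.sum_apply, mul_apply, ← Finset.sum_coe_sort T, ← σ.sum_comp]
    rfl
  have hQ : (Q.map (Int.castRingHom ℝ)).det = Q.det := (RingHom.map_det _ Q).symm
  rw [hgram, det_mul, det_transpose, hfac, det_mul, hQ, ← sq, mul_pow, hD]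
  split_ifs with hconn
  · have h := det_reducedIncidence_sq_of_connected σ hconn
    have h' : ((Q.det : ℤ) : ℝ) ^ 2 = 1 := mod_cast h
    simp [h']
  · have h : Q.det = 0 := det_reducedIncidence_of_not_connected σ hconn
    simp [h]

/-- weighted matrix-tree identity:
`det(Vᵀ L_γ V) = ((1ᵀw)²/‖w‖²) ∑_{T ∈ spt(G)} ∏_{(i,j)∈T} [v0⁻¹γ_{ij} + v1⁻¹(1-γ_{ij})]`. -/
theorem statement_2 {p : ℕ} (hp : 2 ≤ p) (E : Finset (Fin p × Fin p))
    (hE : ∀ e ∈ E, e.1 < e.2)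
    (hconn : (graphOf E).Connected)
    (γ : Fin p × Fin p → ℝ) (hγ : ∀ e ∈ E, γ e = 0 ∨ γ e = 1)
    (v0 v1 : ℝ) (hv0 : 0 < v0) (hv1 : 0 < v1)
    (w : Fin p → ℝ) (hw : (∑ i, w i) ≠ 0)
    (V : Matrix (Fin p) (Fin (p - 1)) ℝ)
    (hVorth : Vᵀ * V = 1) (hVw : Vᵀ.mulVec w = 0) :
    (Vᵀ * wlap E (fun e => v0⁻¹ * γ e + v1⁻¹ * (1 - γ e)) * V).det
      = ((∑ i, w i) ^ 2 / (∑ i, (w i) ^ 2)) *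
        ∑ T ∈ spanningTrees E, ∏ e ∈ T, (v0⁻¹ * γ e + v1⁻¹ * (1 - γ e)) := by
  obtain ⟨n, rfl⟩ : ∃ n, p = n + 1 := ⟨p - 1, by omega⟩
  change Matrix (Fin (n + 1)) (Fin n) ℝ at V
  set c : Fin (n + 1) × Fin (n + 1) → ℝ := fun e => v0⁻¹ * γ e + v1⁻¹ * (1 - γ e) with hc
  have hcompress : Vᵀ * wlap E c * V =
      ∑ e ∈ E, c e • vecMulVec (edgeVec e ᵥ* V) (edgeVec e ᵥ* V) := by
    rw [wlap, Matrix.mul_sum, Matrix.sum_mul]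
    refine Finset.sum_congr rfl fun e _ => ?_
    rw [Matrix.mul_smul, Matrix.smul_mul, mul_vecMulVec, vecMulVec_mul, mulVec_transpose]
  have hdet : (Vᵀ * wlap E c * V).det = ∑ T ∈ E.powersetCard n, (∏ e ∈ T, c e) *
      if (graphOf T).Connected then (∑ i, w i) ^ 2 / ∑ i, w i ^ 2 else 0 := by
    rw [hcompress, det_sum_smul_vecMulVec_eq_sum_powersetCard, Fintype.card_fin]
    refine Finset.sum_congr rfl fun T hT => ?_
    rw [det_sum_vecMulVec_edgeVec T (Finset.mem_powersetCard.mp hT).2 w hw V hVorth hVw]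
  have hspan : spanningTrees E = {T ∈ E.powersetCard n | (graphOf T).Connected} := by
    ext T
    simp [spanningTrees, and_assoc]
  refine hdet.trans ?_
  rw [hspan, Finset.sum_filter, Finset.mul_sum]
  refine Finset.sum_congr rfl fun T _ => ?_
  split_ifs
  · exact mul_comm _ _
  · rw [mul_zero, mul_zero]
end
end

section
/- Let G be a tree on vertex set {1,…,p} with p ≥ 2 (a connected simple graph with exactly p − 1 edges), let γ ∈ {0,1}^E and v0, v1 ∈ (0,∞), and let L_γ be the weighted Laplacian with edge weights v0⁻¹γ_e + v1⁻¹(1−γ_e). Let w ∈ ℝ^p with 1_pᵀw ≠ 0 and let V ∈ ℝ^{p×(p−1)} have orthonormal columns with Vᵀw = 0. Then det(VᵀL_γV) = ((1_pᵀw)² / ‖w‖²) · Π_{(i,j)∈E} [v0⁻¹γ_{ij} + v1⁻¹(1−γ_{ij})]. -/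
open Matrix BigOperators Finset
open scoped Classical

noncomputable section

/-- If `V` has orthonormal columns orthogonal to `w`, then `det (Vᵀ A)` is, up to sign and the
factor `‖w‖`, the determinant of the bordered matrix `[A | w]`. -/
lemma det_transpose_mul_sq_mul {m : Type*} [Fintype m] [DecidableEq m]
    (A V : Matrix (m ⊕ Unit) m ℝ) (w : m ⊕ Unit → ℝ) (hw : w ⬝ᵥ w ≠ 0)
    (hV : Vᵀ * V = 1) (hVw : Vᵀ *ᵥ w = 0) :
    (Vᵀ * A).det ^ 2 * (w ⬝ᵥ w) = (fromCols A (replicateCol Unit w)).det ^ 2 := by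
  have hcol : Vᵀ * replicateCol Unit w = 0 := by
    rw [← replicateCol_mulVec, hVw, replicateCol_zero]
  have hrow : replicateRow Unit w * V = 0 := by
    rw [← replicateRow_vecMul, ← mulVec_transpose, hVw, replicateRow_zero]
  have hww : (replicateRow Unit w * replicateCol Unit w).det = w ⬝ᵥ w := by
    rw [det_unique]; rfl
  have hU : (fromCols V (replicateCol Unit w)).det ^ 2 = w ⬝ᵥ w := by
    have h : (fromCols V (replicateCol Unit w))ᵀ * fromCols V (replicateCol Unit w) =
        fromBlocks 1 0 0 (replicateRow Unit w * replicateCol Unit w) := by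
      rw [transpose_fromCols, transpose_replicateCol, fromRows_mul_fromCols, hV, hcol, hrow]
    have h' := congrArg det h
    rwa [det_mul, det_transpose, det_fromBlocks_zero₂₁, det_one, one_mul, hww, ← sq] at h'
  have hUA : (fromCols V (replicateCol Unit w)).det * (fromCols A (replicateCol Unit w)).det =
      (Vᵀ * A).det * (w ⬝ᵥ w) := by
    rw [← det_transpose (fromCols V _), ← det_mul, transpose_fromCols, transpose_replicateCol,
      fromRows_mul_fromCols, hcol, det_fromBlocks_zero₁₂, hww]
  have h := congrArg (· ^ 2) hUA
  simp only [mul_pow, hU] at h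
  exact mul_left_cancel₀ hw (by linear_combination -h)

/-- If the differences `e_v - e_r` are integral combinations of the columns of the integer
matrix `A`, then bordering `A` by `w` gives determinant `± ∑ v, w v`. -/
lemma det_fromCols_replicateCol_sq {m : Type*} [Fintype m] [DecidableEq m]
    (A : Matrix (m ⊕ Unit) m ℤ) (r : m ⊕ Unit)
    (hA : ∀ v, ∃ x : m → ℤ, A *ᵥ x = Pi.single v 1 - Pi.single r 1) (w : m ⊕ Unit → ℝ) :
    (fromCols (A.map (Int.cast : ℤ → ℝ)) (replicateCol Unit w)).det ^ 2 = (∑ v, w v) ^ 2 := by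
  choose R hR using hA
  set Q : Matrix m (m ⊕ Unit) ℤ := (of R)ᵀ
  have hAQ : A * Q = 1 - vecMulVec (Pi.single r 1) 1 := by
    ext i v
    have h : (A * Q) i v = (A *ᵥ R v) i := rfl
    rw [h, hR]
    simp [one_apply, Pi.single_apply]
  have hunit : IsUnit (fromCols A (replicateCol Unit (Pi.single r 1))).det := by
    refine isUnit_det_of_right_inverse (B := fromRows Q (replicateRow Unit 1)) ?_
    rw [fromCols_mul_fromRows, hAQ, vecMulVec_eq Unit, sub_add_cancel]
  have hAQ' : A.map (Int.cast : ℤ → ℝ) * Q.map (Int.cast : ℤ → ℝ) =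
      1 - vecMulVec (Pi.single r 1) 1 := by
    have h := congrArg (fun M => M.map (Int.castRingHom ℝ)) hAQ
    simp only [Matrix.map_mul] at h
    refine h.trans ?_
    ext i v
    simp [one_apply, Pi.single_apply]
  have hfac : fromCols (A.map (Int.cast : ℤ → ℝ)) (replicateCol Unit w) =
      (fromCols A (replicateCol Unit (Pi.single r 1))).map (Int.castRingHom ℝ) *
        fromBlocks 1 (replicateCol Unit (Q.map (Int.cast : ℤ → ℝ) *ᵥ w)) 0
          (of fun _ _ => ∑ v, w v) := by
    have hmap : (fromCols A (replicateCol Unit (Pi.single r 1))).map (Int.castRingHom ℝ) =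
        fromCols (A.map (Int.cast : ℤ → ℝ)) (replicateCol Unit (Pi.single r 1)) := by
      ext i (j | j) <;> simp [Pi.single_apply]
    rw [hmap, fromCols_mul_fromBlocks, Matrix.mul_one, Matrix.mul_zero, add_zero,
      ← replicateCol_mulVec, mulVec_mulVec, hAQ']
    congr 1
    ext i j
    have h : (vecMulVec (Pi.single r (1 : ℝ)) 1 *ᵥ w) i =
        (Pi.single r 1 : m ⊕ Unit → ℝ) i * ∑ v, w v := by
      simp only [mulVec, dotProduct, vecMulVec_apply, Pi.one_apply, mul_one, Finset.mul_sum]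
    rw [Matrix.add_apply, replicateCol_apply, replicateCol_apply, sub_mulVec, one_mulVec, Pi.sub_apply,
      h, Matrix.mul_apply]
    simp only [Finset.univ_unique, Finset.sum_singleton, replicateCol_apply, of_apply,
      sub_add_cancel]
  have hsq : ((fromCols A (replicateCol Unit (Pi.single r 1))).map (Int.castRingHom ℝ)).det ^ 2
      = 1 := by
    have h := Int.isUnit_sq hunit
    rw [← RingHom.mapMatrix_apply, ← RingHom.map_det, ← map_pow, h, map_one]
  rw [hfac, det_mul, mul_pow, hsq, det_fromBlocks_zero₂₁, det_one, det_unique]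
  simp

/-- In a graph, the difference of the indicators of two vertices joined by a walk is an integral
combination of the columns of any matrix whose columns contain, for every adjacent pair `u`, `v`,
`e_u - e_v` up to sign. -/
lemma exists_mulVec_eq_single_sub_single {ι m : Type*} [DecidableEq ι] [Fintype m]
    [DecidableEq m] {G : SimpleGraph ι} (A : Matrix ι m ℤ)
    (hA : ∀ u v, G.Adj u v → ∃ j, A.col j = Pi.single u 1 - Pi.single v 1 ∨
      A.col j = Pi.single v 1 - Pi.single u 1) {u v : ι} (p : G.Walk u v) :
    ∃ x : m → ℤ, A *ᵥ x = Pi.single v 1 - Pi.single u 1 := by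
  induction p with
  | nil => exact ⟨0, by simp⟩
  | cons h _ ih =>
    obtain ⟨x, hx⟩ := ih
    obtain ⟨j, hj | hj⟩ := hA _ _ h
    · exact ⟨x - Pi.single j 1, by rw [mulVec_sub, hx, mulVec_single_one, hj]; abel⟩
    · exact ⟨x + Pi.single j 1, by rw [mulVec_add, hx, mulVec_single_one, hj]; abel⟩

/-- for a tree base graph (connected with `p - 1` edges),
`det(Vᵀ L_γ V) = ((1ᵀw)²/‖w‖²) ∏_{(i,j)∈E} [v0⁻¹γ_{ij} + v1⁻¹(1-γ_{ij})]`. -/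
theorem statement_3 {p : ℕ} (hp : 2 ≤ p) (E : Finset (Fin p × Fin p))
    (hE : ∀ e ∈ E, e.1 < e.2)
    (hconn : (graphOf E).Connected) (htree : E.card = p - 1)
    (γ : Fin p × Fin p → ℝ) (hγ : ∀ e ∈ E, γ e = 0 ∨ γ e = 1)
    (v0 v1 : ℝ) (hv0 : 0 < v0) (hv1 : 0 < v1)
    (w : Fin p → ℝ) (hw : (∑ i, w i) ≠ 0)
    (V : Matrix (Fin p) (Fin (p - 1)) ℝ)
    (hVorth : Vᵀ * V = 1) (hVw : Vᵀ.mulVec w = 0) :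
    (Vᵀ * wlap E (fun e => v0⁻¹ * γ e + v1⁻¹ * (1 - γ e)) * V).det
      = ((∑ i, w i) ^ 2 / (∑ i, (w i) ^ 2)) *
        ∏ e ∈ E, (v0⁻¹ * γ e + v1⁻¹ * (1 - γ e)) := by
  have hp' : Fintype.card (Fin (p - 1) ⊕ Unit) = Fintype.card (Fin p) := by
    simp; omega
  let σ : Fin (p - 1) ⊕ Unit ≃ Fin p := Fintype.equivOfCardEq hp'
  let ε : E ≃ Fin (p - 1) := Finset.equivFinOfCardEq htree
  let edge : Fin (p - 1) → Fin p × Fin p := fun j => (ε.symm j).1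
  set c : Fin p × Fin p → ℝ := fun e => v0⁻¹ * γ e + v1⁻¹ * (1 - γ e)
  let B : Matrix (Fin p) (Fin (p - 1)) ℤ :=
    of fun i j => (Pi.single (edge j).1 1 - Pi.single (edge j).2 1 : Fin p → ℤ) i
  have hadj : ∀ u v, (graphOf E).Adj u v → ∃ j, B.col j = Pi.single u 1 - Pi.single v 1 ∨
      B.col j = Pi.single v 1 - Pi.single u 1 := by
    intro u v huv
    obtain ⟨-, h | h⟩ := (SimpleGraph.fromRel_adj _ _ _).1 huv
    · exact ⟨ε ⟨_, h⟩, Or.inl (by ext i; simp [B, edge])⟩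
    · exact ⟨ε ⟨_, h⟩, Or.inr (by ext i; simp [B, edge])⟩
  let A : Matrix (Fin (p - 1) ⊕ Unit) (Fin (p - 1)) ℤ := B.submatrix σ id
  have hA : ∀ v, ∃ x, A *ᵥ x = Pi.single v 1 - Pi.single (Sum.inr ()) 1 := by
    intro v
    obtain ⟨q⟩ := hconn.preconnected (σ (Sum.inr ())) (σ v)
    obtain ⟨x, hx⟩ := exists_mulVec_eq_single_sub_single B hadj q
    refine ⟨x, funext fun i => ?_⟩
    refine (congrFun hx (σ i)).trans ?_
    simp [Pi.single_apply]
  have hww : ∑ i, w i ^ 2 ≠ 0 := by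
    intro h
    rw [Finset.sum_eq_zero_iff_of_nonneg fun i _ => sq_nonneg (w i)] at h
    exact hw (Finset.sum_eq_zero fun i hi => pow_eq_zero_iff two_ne_zero |>.1 (h i hi))
  have hdot : (w ∘ σ) ⬝ᵥ (w ∘ σ) = ∑ i, w i ^ 2 := by
    simp only [dotProduct, Function.comp_apply, ← sq]
    exact σ.sum_comp fun i => w i ^ 2
  let BR : Matrix (Fin p) (Fin (p - 1)) ℝ := B.map (Int.cast : ℤ → ℝ)
  have hVA : (V.submatrix σ id)ᵀ * A.map (Int.cast : ℤ → ℝ) = Vᵀ * BR := by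
    ext i j
    simp only [Matrix.mul_apply, transpose_apply, submatrix_apply, id]
    exact σ.sum_comp fun k => V k i * BR k j
  have hdet : (Vᵀ * BR).det ^ 2 * ∑ i, w i ^ 2 = (∑ i, w i) ^ 2 := by
    have h := det_transpose_mul_sq_mul (A.map (Int.cast : ℤ → ℝ)) (V.submatrix σ id) (w ∘ σ)
      (by rwa [hdot]) ?_ ?_
    · rw [det_fromCols_replicateCol_sq A _ hA, hVA, hdot] at h
      rw [h]
      exact congrArg (· ^ 2) (σ.sum_comp w)
    · rw [← hVorth]
      ext i j
      simp only [Matrix.mul_apply, transpose_apply, submatrix_apply, id]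
      exact σ.sum_comp fun k => V k i * V k j
    · rw [← hVw]
      ext i
      simp only [mulVec, dotProduct, transpose_apply, submatrix_apply, id, Function.comp_apply]
      exact σ.sum_comp fun k => V k i * w k
  have hL : wlap E c = BR * diagonal (c ∘ edge) * BRᵀ := by
    ext i k
    rw [wlap, Matrix.sum_apply, Matrix.mul_apply, ← Finset.sum_coe_sort E, ← ε.symm.sum_comp]
    refine Finset.sum_congr rfl fun j _ => ?_
    simp [mul_diagonal, BR, B, edge, edgeVec, vecMulVec_apply, Pi.single_apply]
    ring
  have hprod : ∏ j, (c ∘ edge) j = ∏ e ∈ E, c e := by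
    rw [← Finset.prod_coe_sort E, ← ε.symm.prod_comp]
    rfl
  have hfac : Vᵀ * wlap E c * V = Vᵀ * BR * diagonal (c ∘ edge) * (Vᵀ * BR)ᵀ := by
    rw [hL, transpose_mul, transpose_transpose]
    simp only [Matrix.mul_assoc]
  rw [hfac, det_mul, det_mul, det_transpose, det_diagonal, hprod, ← hdet,
    mul_div_cancel_right₀ _ hww]
  ring
end
end

section
/- Let G be a finite simple graph on vertex set {1,…,p} with p ≥ 2, with incidence matrix D ∈ ℝ^{|E|×p}, and let U ∈ ℝ^{p×(p−1)} have orthonormal columns with Uᵀ1_p = 0. For any subset S ⊆ E with |S| = p − 1, writing D_{S*} for the submatrix of D consisting of the rows indexed by S, one has det(Uᵀ D_{S*}ᵀ D_{S*} U) = p if the graph ({1,…,p}, S) is connected (i.e., S is a spanning tree), and det(Uᵀ D_{S*}ᵀ D_{S*} U) = 0 otherwise. -/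
open Matrix BigOperators Finset
open scoped Classical

noncomputable section

/-- A predicate that agrees on the ends of every listed edge is invariant under reachability. -/
theorem eq_of_reachable_graphOf {p : ℕ} {S : Finset (Fin p × Fin p)} {P : Fin p → Prop}
    (hP : ∀ e ∈ S, P e.1 ↔ P e.2) {i j : Fin p} (h : (graphOf S).Reachable i j) : P i ↔ P j := by
  obtain ⟨w⟩ := h
  induction w with
  | nil => rfl
  | cons hadj _ ih =>
    rw [← ih]
    rcases (SimpleGraph.fromRel_adj _ _ _).1 hadj with ⟨-, h | h⟩
    · exact hP _ h
    · exact (hP _ h).symm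

/-- The integer incidence matrix of the edges `g i`, with the standard basis vector at `k` as an
additional row. -/
def rootedIncidence {p : ℕ} {ι : Type*} (g : ι → Fin p × Fin p) (k : Fin p) :
    Matrix (ι ⊕ Unit) (Fin p) ℤ :=
  Matrix.fromRows (Matrix.of fun i => Pi.single (g i).1 1 - Pi.single (g i).2 1)
    (Matrix.of fun _ => Pi.single k 1)

theorem rootedIncidence_map {p : ℕ} {ι : Type*} (g : ι → Fin p × Fin p) (k : Fin p) :
    (rootedIncidence g k).map (Int.cast : ℤ → ℝ) =
      Matrix.fromRows (Matrix.of fun i => edgeVec (g i)) (Matrix.of fun _ => Pi.single k 1) := by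
  ext (i | i) j <;> simp [rootedIncidence, edgeVec, Pi.single_apply]

/-- For a connected graph the rooted incidence matrix has an integer left inverse. -/
theorem exists_mul_rootedIncidence_eq_one {p : ℕ} {ι : Type*} [Fintype ι]
    {S : Finset (Fin p × Fin p)} {g : ι → Fin p × Fin p} (hg : ∀ e ∈ S, ∃ i, g i = e) (k : Fin p)
    (hS : (graphOf S).Connected) :
    ∃ N : Matrix (Fin p) (ι ⊕ Unit) ℤ, N * rootedIncidence g k = 1 := by
  set M := rootedIncidence g k with hM
  have hrow : ∀ x, M x ∈ Submodule.span ℤ (Set.range M.row) :=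
    fun x => Submodule.subset_span ⟨x, rfl⟩
  have hk : (Pi.single k 1 : Fin p → ℤ) ∈ Submodule.span ℤ (Set.range M.row) := hrow (Sum.inr ())
  have hmem : ∀ j, (Pi.single j 1 : Fin p → ℤ) ∈ Submodule.span ℤ (Set.range M.row) := by
    intro j
    refine (eq_of_reachable_graphOf (S := S)
      (P := fun j => (Pi.single j 1 : Fin p → ℤ) ∈ Submodule.span ℤ (Set.range M.row)) ?_
      (hS.preconnected k j)).1 hk
    intro e he
    obtain ⟨i, rfl⟩ := hg e he
    have hi : (Pi.single (g i).1 1 - Pi.single (g i).2 1 : Fin p → ℤ) ∈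
      Submodule.span ℤ (Set.range M.row) := hrow (Sum.inl i)
    constructor <;> intro h
    · simpa using Submodule.sub_mem _ h hi
    · simpa using Submodule.add_mem _ hi h
  simp_rw [← range_vecMulLinear, LinearMap.mem_range, Matrix.vecMulLinear_apply] at hmem
  choose N hN using hmem
  refine ⟨Matrix.of N, ?_⟩
  ext i j
  rw [Matrix.one_apply]
  refine (congrFun (hN i) j).trans ?_
  simp [Pi.single_apply, eq_comm]

/-- For a disconnected graph the rooted incidence matrix has a nonzero kernel. -/
theorem exists_rootedIncidence_mulVec_eq_zero {p : ℕ} {ι : Type*}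
    {S : Finset (Fin p × Fin p)} {g : ι → Fin p × Fin p} (hg : ∀ i, g i ∈ S)
    (hlt : ∀ e ∈ S, e.1 < e.2) (k : Fin p) (hS : ¬ (graphOf S).Connected) :
    ∃ v : Fin p → ℤ, v ≠ 0 ∧ rootedIncidence g k *ᵥ v = 0 := by
  obtain ⟨j, hj⟩ : ∃ j, ¬ (graphOf S).Reachable k j := by
    by_contra! h
    exact hS ((SimpleGraph.connected_iff_exists_forall_reachable _).2 ⟨k, h⟩)
  refine ⟨fun i => if (graphOf S).Reachable k i then 0 else 1,
    fun h => by simpa [hj] using congrFun h j, ?_⟩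
  ext (i | i)
  · have hadj : (graphOf S).Adj (g i).1 (g i).2 :=
      (SimpleGraph.fromRel_adj _ _ _).2 ⟨(hlt _ (hg i)).ne, Or.inl (hg i)⟩
    have : (graphOf S).Reachable k (g i).1 ↔ (graphOf S).Reachable k (g i).2 :=
      ⟨fun h => h.trans hadj.reachable, fun h => h.trans hadj.symm.reachable⟩
    change (Pi.single (g i).1 1 - Pi.single (g i).2 1 : Fin p → ℤ) ⬝ᵥ _ = _
    simp [sub_dotProduct, this]
  · simp [rootedIncidence, Matrix.mulVec]

/-- Compressing the Gram matrix of zero-sum rows `B` to the orthogonal complement of the all-ones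
vector multiplies the squared determinant of `B` with a standard basis row by the dimension. -/
theorem det_compression_eq {p : ℕ} {ι : Type*} [Fintype ι] [DecidableEq ι]
    (f : ι ⊕ Unit ≃ Fin p) {U : Matrix (Fin p) ι ℝ} (hUorth : Uᵀ * U = 1)
    (hU1 : Uᵀ *ᵥ (fun _ => 1) = 0) {B : Matrix ι (Fin p) ℝ} (hB : B *ᵥ (fun _ => 1) = 0)
    (k : Fin p) :
    (Uᵀ * (Bᵀ * B) * U).det =
      ((Matrix.fromRows B (Matrix.of fun _ : Unit => Pi.single k 1)).submatrix id f).det ^ 2 *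
        p := by
  set R : Matrix Unit (Fin p) ℝ := Matrix.of fun _ => Pi.single k 1 with hR
  set J : Matrix (Fin p) Unit ℝ := Matrix.of fun _ _ => 1 with hJ
  set Q := Matrix.fromCols U J with hQ
  have hUJ : Uᵀ * J = 0 := by
    ext i j; exact congrFun hU1 i
  have hJU : Jᵀ * U = 0 := by
    rw [← Matrix.transpose_transpose U, ← Matrix.transpose_mul, hUJ, Matrix.transpose_zero]
  have hBJ : B * J = 0 := by
    ext i j; exact congrFun hB i
  have hQQ : (Q.submatrix f id).det ^ 2 = p := by
    have h : (Q.submatrix f id)ᵀ * Q.submatrix f id = Matrix.fromBlocks 1 0 0 (Jᵀ * J) := by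
      rw [Matrix.transpose_submatrix, Matrix.submatrix_mul_equiv, hQ, Matrix.transpose_fromCols,
        Matrix.fromRows_mul_fromCols, hUorth, hUJ, hJU, Matrix.submatrix_id_id]
    have := congrArg Matrix.det h
    rw [Matrix.det_mul, Matrix.det_transpose, Matrix.det_fromBlocks_zero₂₁, Matrix.det_one,
      one_mul] at this
    rw [sq, this]
    simp [hJ, Matrix.mul_apply]
  have hMQ : ((Matrix.fromRows B R).submatrix id f).det * (Q.submatrix f id).det =
      (B * U).det := by
    rw [← Matrix.det_mul, Matrix.submatrix_mul_equiv, hQ, Matrix.fromRows_mul_fromCols, hBJ,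
      Matrix.submatrix_id_id, Matrix.det_fromBlocks_zero₁₂]
    simp [hR, hJ, Matrix.mul_apply]
  have : Uᵀ * (Bᵀ * B) * U = (B * U)ᵀ * (B * U) := by
    simp only [Matrix.transpose_mul, Matrix.mul_assoc]
  rw [this, Matrix.det_mul, Matrix.det_transpose, ← hMQ, ← hQQ]
  ring

theorem wlap_one_eq_transpose_mul {p : ℕ} {ι : Type*} [Fintype ι] {S : Finset (Fin p × Fin p)}
    (g : ι ≃ S) :
    wlap S (fun _ => 1) = (Matrix.of fun i => edgeVec (g i).1)ᵀ *
      (Matrix.of fun i => edgeVec (g i).1 : Matrix ι (Fin p) ℝ) := by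
  ext a b
  rw [wlap, ← Finset.sum_coe_sort, ← g.sum_comp]
  simp [Matrix.sum_apply, Matrix.mul_apply, Matrix.vecMulVec_apply]

/-- for any `S ⊆ E` with `|S| = p - 1` and orthonormal `U` with
`Uᵀ1 = 0`, `det(Uᵀ D_{S*}ᵀ D_{S*} U)` equals `p` if `(V,S)` is connected (a spanning
tree) and `0` otherwise. -/
theorem statement_4 {p : ℕ} (hp : 2 ≤ p) (E : Finset (Fin p × Fin p))
    (hE : ∀ e ∈ E, e.1 < e.2)
    (U : Matrix (Fin p) (Fin (p - 1)) ℝ)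
    (hUorth : Uᵀ * U = 1) (hU1 : Uᵀ.mulVec (fun _ => 1) = 0)
    (S : Finset (Fin p × Fin p)) (hS : S ⊆ E) (hScard : S.card = p - 1) :
    ((graphOf S).Connected → (Uᵀ * wlap S (fun _ => 1) * U).det = p) ∧
    (¬ (graphOf S).Connected → (Uᵀ * wlap S (fun _ => 1) * U).det = 0) := by
  have g : Fin (p - 1) ≃ S := (Fintype.equivFinOfCardEq (by simpa using hScard)).symm
  have f : Fin (p - 1) ⊕ Unit ≃ Fin p := Fintype.equivOfCardEq (by simp; omega)
  set k : Fin p := ⟨0, by omega⟩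
  set M := (rootedIncidence (fun i => (g i).1) k).submatrix id f with hM
  have hdet : (Uᵀ * wlap S (fun _ => 1) * U).det = (M.det : ℝ) ^ 2 * p := by
    rw [wlap_one_eq_transpose_mul g, det_compression_eq f hUorth hU1 _ k, ← rootedIncidence_map,
      Int.cast_det, hM]
    · rfl
    · ext i
      simp [Matrix.mulVec, dotProduct, edgeVec]
  rw [hdet]
  constructor
  · intro hconn
    obtain ⟨N, hN⟩ := exists_mul_rootedIncidence_eq_one (g := fun i => (g i).1)
      (fun e he => ⟨g.symm ⟨e, he⟩, by simp⟩) k hconn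
    have h : N.submatrix f id * M = 1 := by
      rw [hM, ← Matrix.submatrix_mul _ _ f id f Function.bijective_id, hN,
        Matrix.submatrix_one_equiv]
    have hu : IsUnit M.det := (Matrix.isUnit_iff_isUnit_det M).1 (IsUnit.of_mul_eq_one_right _ h)
    have : M.det ^ 2 = 1 := Int.isUnit_sq hu
    rw [← Int.cast_pow, this, Int.cast_one, one_mul]
  · intro hconn
    obtain ⟨v, hv0, hv⟩ := exists_rootedIncidence_mulVec_eq_zero (g := fun i => (g i).1)
      (fun i => (g i).2) (fun e he => hE e (hS he)) k hconn
    have : M.det = 0 := by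
      refine Matrix.exists_mulVec_eq_zero_iff.1 ⟨v ∘ f, fun h => hv0 ?_, ?_⟩
      · ext i
        simpa using congrFun h (f.symm i)
      · rw [hM, Matrix.submatrix_mulVec_equiv]
        simp [Function.comp_assoc, hv]
    simp [this]
end
end

section
/- (Variational lower bound via effective resistances.) Let G be a connected finite simple graph on {1,…,p} with p ≥ 2 and let a : E → (0,∞) be positive numbers. Then log( Σ_{T ∈ spt(G)} Π_{e∈T} a_e ) ≥ Σ_{e∈E} r_e · log a_e + log|spt(G)|, where r_e = |{T ∈ spt(G) : e ∈ T}| / |spt(G)| is the effective resistance of edge e. -/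
open Matrix BigOperators Finset
open scoped Classical

noncomputable section

/-- A finite sum of positive reals is at least the number of terms times their geometric mean,
in logarithmic form. -/
theorem sum_log_div_card_add_log_card_le_log_sum {ι : Type*} (s : Finset ι) (w : ι → ℝ)
    (hw : ∀ i ∈ s, 0 < w i) :
    (∑ i ∈ s, Real.log (w i)) / (s.card : ℝ) + Real.log (s.card : ℝ)
      ≤ Real.log (∑ i ∈ s, w i) := by
  rcases s.eq_empty_or_nonempty with rfl | hs
  · simp
  have hN : (0 : ℝ) < s.card := by exact_mod_cast hs.card_pos
  have hJensen := strictConcaveOn_log_Ioi.concaveOn.le_map_sum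
    (t := s) (w := fun _ => (s.card : ℝ)⁻¹) (p := w) (fun _ _ => by positivity)
    (by simp [hN.ne']) hw
  simp only [smul_eq_mul, ← Finset.mul_sum] at hJensen
  rw [Real.log_mul (inv_ne_zero hN.ne') (Finset.sum_pos hw hs).ne', Real.log_inv] at hJensen
  rw [div_eq_inv_mul]
  linarith

/-- Double counting of incidences: weighting each element of `E` by the proportion of members of
a family `S` of subsets of `E` containing it amounts to averaging over `S`. -/
theorem sum_card_filter_mem_div_card_mul {α : Type*} [DecidableEq α] (E : Finset α)
    (S : Finset (Finset α)) (hS : ∀ T ∈ S, T ⊆ E) (f : α → ℝ) :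
    ∑ e ∈ E, ((S.filter (fun T => e ∈ T)).card : ℝ) / (S.card : ℝ) * f e
      = (∑ T ∈ S, ∑ e ∈ T, f e) / (S.card : ℝ) := by
  have hcount : ∑ T ∈ S, ∑ e ∈ T, f e
      = ∑ e ∈ E, ((S.filter (fun T => e ∈ T)).card : ℝ) * f e := by
    calc ∑ T ∈ S, ∑ e ∈ T, f e = ∑ T ∈ S, ∑ e ∈ E, if e ∈ T then f e else 0 := by
          refine Finset.sum_congr rfl fun T hT => ?_
          rw [← Finset.sum_filter, Finset.filter_mem_eq_inter,
            Finset.inter_eq_right.mpr (hS T hT)]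
      _ = _ := by
          rw [Finset.sum_comm]
          refine Finset.sum_congr rfl fun e _ => ?_
          rw [← Finset.sum_filter, Finset.sum_const, nsmul_eq_mul]
  rw [hcount, Finset.sum_div]
  exact Finset.sum_congr rfl fun e _ => by ring

/-- variational lower bound via effective resistances:
`log(∑_{T∈spt(G)} ∏_{e∈T} a_e) ≥ ∑_{e∈E} r_e log a_e + log|spt(G)|`, where
`r_e = |{T ∈ spt(G) : e ∈ T}|/|spt(G)|` is the effective resistance of `e`. -/
theorem statement_5 {p : ℕ} (hp : 2 ≤ p) (E : Finset (Fin p × Fin p))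
    (hE : ∀ e ∈ E, e.1 < e.2)
    (hconn : (graphOf E).Connected)
    (a : Fin p × Fin p → ℝ) (ha : ∀ e ∈ E, 0 < a e) :
    Real.log (∑ T ∈ spanningTrees E, ∏ e ∈ T, a e)
      ≥ (∑ e ∈ E, ((((spanningTrees E).filter (fun T => e ∈ T)).card : ℝ) /
            ((spanningTrees E).card : ℝ)) * Real.log (a e))
        + Real.log ((spanningTrees E).card : ℝ) := by
  have hsub : ∀ T ∈ spanningTrees E, T ⊆ E := fun T hT =>
    Finset.mem_powerset.mp (Finset.mem_filter.mp hT).1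
  have hlog : ∑ T ∈ spanningTrees E, ∑ e ∈ T, Real.log (a e)
      = ∑ T ∈ spanningTrees E, Real.log (∏ e ∈ T, a e) :=
    Finset.sum_congr rfl fun T hT =>
      (Real.log_prod fun e he => (ha e (hsub T hT he)).ne').symm
  have hcount := sum_card_filter_mem_div_card_mul E _ hsub fun e => Real.log (a e)
  have hmean := sum_log_div_card_add_log_card_le_log_sum (spanningTrees E)
    (fun T => ∏ e ∈ T, a e) fun T hT => Finset.prod_pos fun e he => ha e (hsub T hT he)
  rw [← hlog, ← hcount] at hmean
  convert hmean
end
end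

section
/- Let G be a connected finite simple graph on vertex set {1,…,p} with p ≥ 2, let L ∈ ℝ^{p×p} be its (unweighted) graph Laplacian, and let P ∈ ℝ^{p×p} be any matrix satisfying the four Moore–Penrose equations for L (LPL = L, PLP = P, (LP)ᵀ = LP, (PL)ᵀ = PL). Then for every edge (i,j) ∈ E, |spt(G)| · (e_i − e_j)ᵀ P (e_i − e_j) = |{T ∈ spt(G) : (i,j) ∈ T}|; that is, the effective resistance satisfies r_{ij} = (e_i − e_j)ᵀ L⁺ (e_i − e_j). -/
open Matrix BigOperators Finset
open scoped Classical

noncomputable section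

theorem edgeVec_dotProduct {p : ℕ} (e : Fin p × Fin p) (g : Fin p → ℝ) :
    edgeVec e ⬝ᵥ g = g e.1 - g e.2 := by
  simp [edgeVec, dotProduct, sub_mul, Finset.sum_sub_distrib]

theorem wlap_one_mulVec {p : ℕ} (E : Finset (Fin p × Fin p)) (w : Fin p → ℝ) :
    wlap E (fun _ => 1) *ᵥ w = ∑ f ∈ E, (edgeVec f ⬝ᵥ w) • edgeVec f := by
  simp only [wlap, one_smul, Matrix.sum_mulVec]
  refine Finset.sum_congr rfl fun f _ => ?_
  ext k
  simp [Matrix.vecMulVec_mulVec, mul_comm]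

theorem transpose_wlap {p : ℕ} (E : Finset (Fin p × Fin p)) (c : Fin p × Fin p → ℝ) :
    (wlap E c)ᵀ = wlap E c := by
  simp [wlap, Matrix.transpose_sum, Matrix.transpose_smul, Matrix.transpose_vecMulVec]

/-- The indicator vector of the connected component of `i` in the graph with edge set `S`. -/
def componentVec {p : ℕ} (S : Finset (Fin p × Fin p)) (i : Fin p) : Fin p → ℝ :=
  fun k => if (graphOf S).Reachable i k then 1 else 0

theorem edgeVec_dotProduct_componentVec_of_mem {p : ℕ} {S : Finset (Fin p × Fin p)} (i : Fin p)
    {s : Fin p × Fin p} (hs : s ∈ S) : edgeVec s ⬝ᵥ componentVec S i = 0 := by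
  rw [edgeVec_dotProduct, sub_eq_zero]
  by_cases hne : s.1 = s.2
  · rw [hne]
  · have hadj : (graphOf S).Adj s.1 s.2 := by
      simp [graphOf, SimpleGraph.fromRel_adj, hne, hs]
    have : (graphOf S).Reachable i s.1 ↔ (graphOf S).Reachable i s.2 :=
      ⟨fun h => h.trans hadj.reachable, fun h => h.trans hadj.symm.reachable⟩
    simp [componentVec, this]

theorem eq_of_connected {p : ℕ} {S : Finset (Fin p × Fin p)} (hS : (graphOf S).Connected)
    {g : Fin p → ℝ} (hg : ∀ s ∈ S, edgeVec s ⬝ᵥ g = 0) (a b : Fin p) : g a = g b := by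
  obtain ⟨w⟩ := hS.preconnected a b
  induction w with
  | nil => rfl
  | cons h _ ih =>
    rw [← ih]
    rw [graphOf, SimpleGraph.fromRel_adj] at h
    rcases h.2 with h | h
    · have := hg _ h
      rw [edgeVec_dotProduct] at this
      exact sub_eq_zero.mp this
    · have := hg _ h
      rw [edgeVec_dotProduct] at this
      exact (sub_eq_zero.mp this).symm

theorem connected_of_componentVec_eq_one {p : ℕ} {S : Finset (Fin p × Fin p)} {i : Fin p}
    (h : ∀ k, componentVec S i k = 1) : (graphOf S).Connected := by
  have hr : ∀ k, (graphOf S).Reachable i k := fun k => by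
    by_contra hk
    simpa [componentVec, hk] using h k
  have : Nonempty (Fin p) := ⟨i⟩
  exact ⟨fun a b => (hr a).symm.trans (hr b)⟩

theorem componentVec_self {p : ℕ} (S : Finset (Fin p × Fin p)) (i : Fin p) :
    componentVec S i i = 1 := by
  simp [componentVec]

theorem le_card_add_one_of_connected {p : ℕ} {S : Finset (Fin p × Fin p)}
    (hS : (graphOf S).Connected) : p ≤ S.card + 1 := by
  have h := hS.card_vert_le_card_edgeSet_add_one
  have hsub : (graphOf S).edgeSet ⊆ (S.image fun s => s(s.1, s.2) : Finset (Sym2 (Fin p))) := by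
    intro x
    induction x with
    | _ a b =>
      intro hx
      rw [SimpleGraph.mem_edgeSet, graphOf, SimpleGraph.fromRel_adj] at hx
      simp only [coe_image, Set.mem_image]
      rcases hx.2 with hx | hx
      · exact ⟨_, hx, rfl⟩
      · exact ⟨_, hx, Sym2.eq_swap⟩
  have hcard := Set.ncard_le_ncard hsub (Finset.finite_toSet _)
  rw [Set.ncard_coe_finset] at hcard
  have himg := Finset.card_image_le (s := S) (f := fun s => s(s.1, s.2))
  rw [Nat.card_fin, Nat.card_coe_set_eq] at h
  omega

/-- `S` completes to a spanning tree of `E` by the new edge `f`. -/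
def CompletesTo {p : ℕ} (E S : Finset (Fin p × Fin p)) (f : Fin p × Fin p) : Prop :=
  f ∉ S ∧ insert f S ∈ spanningTrees E

theorem CompletesTo.connected {p : ℕ} {E S : Finset (Fin p × Fin p)} {f : Fin p × Fin p}
    (h : CompletesTo E S f) : (graphOf (insert f S)).Connected := by
  have := h.2
  simp only [spanningTrees, mem_filter] at this
  exact this.2.2

theorem CompletesTo.card_add_one {p : ℕ} {E S : Finset (Fin p × Fin p)} {f : Fin p × Fin p}
    (h : CompletesTo E S f) : S.card + 1 = p - 1 := by
  have := h.2
  simp only [spanningTrees, mem_filter] at this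
  rw [← this.2.1, Finset.card_insert_of_notMem h.1]

theorem CompletesTo.subset {p : ℕ} {E S : Finset (Fin p × Fin p)} {f : Fin p × Fin p}
    (h : CompletesTo E S f) : S ⊆ E := by
  have := h.2
  simp only [spanningTrees, mem_filter, mem_powerset] at this
  exact (Finset.subset_insert f S).trans this.1

theorem CompletesTo.dotProduct_ne_zero {p : ℕ} {E S : Finset (Fin p × Fin p)}
    {f : Fin p × Fin p} (h : CompletesTo E S f) (i : Fin p) :
    edgeVec f ⬝ᵥ componentVec S i ≠ 0 := by
  intro h0
  have hS : (graphOf S).Connected := connected_of_componentVec_eq_one (i := i) fun k => by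
    rw [← componentVec_self S i]
    refine eq_of_connected h.connected (fun s hs => ?_) k i
    rcases Finset.mem_insert.mp hs with rfl | hs
    · exact h0
    · exact edgeVec_dotProduct_componentVec_of_mem i hs
  have := le_card_add_one_of_connected hS
  have := h.card_add_one
  omega

theorem CompletesTo.dotProduct_mul_self {p : ℕ} {E S : Finset (Fin p × Fin p)}
    {f : Fin p × Fin p} (h : CompletesTo E S f) (i : Fin p) :
    (edgeVec f ⬝ᵥ componentVec S i) * (edgeVec f ⬝ᵥ componentVec S i) = 1 := by
  have h0 := h.dotProduct_ne_zero i
  rw [edgeVec_dotProduct] at h0 ⊢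
  unfold componentVec at h0 ⊢
  split_ifs at h0 ⊢ <;> simp_all

theorem CompletesTo.dotProduct_fst {p : ℕ} {E S : Finset (Fin p × Fin p)}
    {f : Fin p × Fin p} (h : CompletesTo E S f) :
    edgeVec f ⬝ᵥ componentVec S f.1 = 1 := by
  have h0 := h.dotProduct_ne_zero f.1
  rw [edgeVec_dotProduct, componentVec_self] at h0 ⊢
  unfold componentVec at h0 ⊢
  split_ifs at h0 ⊢ <;> simp_all

/-- Exchange: an edge crossing the cut of a two-component spanning forest completes it. -/
theorem CompletesTo.exchange {p : ℕ} {E S : Finset (Fin p × Fin p)}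
    {f g : Fin p × Fin p} (h : CompletesTo E S f) (hg : g ∈ E) {i : Fin p}
    (hne : edgeVec g ⬝ᵥ componentVec S i ≠ 0) : CompletesTo E S g := by
  have hgS : g ∉ S := fun hgS => hne (edgeVec_dotProduct_componentVec_of_mem i hgS)
  refine ⟨hgS, ?_⟩
  simp only [spanningTrees, mem_filter, mem_powerset]
  refine ⟨Finset.insert_subset hg h.subset, ?_, ?_⟩
  · rw [Finset.card_insert_of_notMem hgS, h.card_add_one]
  · refine connected_of_componentVec_eq_one (i := i) fun k => ?_
    set u := componentVec (insert g S) i with hu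
    set v := componentVec S i with hv
    have hf := h.dotProduct_ne_zero i
    set c := (edgeVec f ⬝ᵥ u) / (edgeVec f ⬝ᵥ v) with hc
    have hconst := eq_of_connected h.connected (g := u - c • v) (fun s hs => by
      rcases Finset.mem_insert.mp hs with rfl | hs
      · rw [dotProduct_sub, dotProduct_smul, hc, smul_eq_mul, div_mul_cancel₀ _ hf, sub_self]
      · rw [dotProduct_sub, dotProduct_smul, edgeVec_dotProduct_componentVec_of_mem i hs,
          edgeVec_dotProduct_componentVec_of_mem i (Finset.mem_insert_of_mem hs)]
        simp)
    have hgu : edgeVec g ⬝ᵥ u = 0 :=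
      edgeVec_dotProduct_componentVec_of_mem i (Finset.mem_insert_self g S)
    have hgc : edgeVec g ⬝ᵥ (u - c • v) = 0 := by
      rw [edgeVec_dotProduct, hconst g.1 g.2, sub_self]
    rw [dotProduct_sub, dotProduct_smul, hgu, zero_sub, neg_eq_zero, smul_eq_mul] at hgc
    have hc0 : c = 0 := (mul_eq_zero.mp hgc).resolve_right hne
    have := hconst k i
    rw [hc0, zero_smul, sub_zero] at this
    rw [this, hu, componentVec_self]

theorem completesTo_erase {p : ℕ} {E T : Finset (Fin p × Fin p)} {f : Fin p × Fin p}
    (hT : T ∈ spanningTrees E) (hf : f ∈ T) : CompletesTo E (T.erase f) f :=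
  ⟨Finset.notMem_erase f T, by rwa [Finset.insert_erase hf]⟩

/-- Expansion of an edge vector in the basis given by a spanning tree. -/
theorem sum_spanningTree_smul_edgeVec {p : ℕ} {E T : Finset (Fin p × Fin p)}
    (hT : T ∈ spanningTrees E) (i : Fin p) (e : Fin p × Fin p) :
    ∑ f ∈ T, ((edgeVec e ⬝ᵥ componentVec (T.erase f) i) *
      (edgeVec f ⬝ᵥ componentVec (T.erase f) i)) • edgeVec f = edgeVec e := by
  ext m
  set g : Fin p → ℝ := ∑ f ∈ T, ((edgeVec f ⬝ᵥ componentVec (T.erase f) i) * edgeVec f m) •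
    componentVec (T.erase f) i - Pi.single m 1 with hg
  have hdot : ∀ s, edgeVec s ⬝ᵥ g = ∑ f ∈ T, ((edgeVec s ⬝ᵥ componentVec (T.erase f) i) *
      (edgeVec f ⬝ᵥ componentVec (T.erase f) i)) * edgeVec f m - edgeVec s m := fun s => by
    rw [hg, dotProduct_sub, dotProduct_sum, dotProduct_single, mul_one]
    congr 1
    refine Finset.sum_congr rfl fun f _ => ?_
    rw [dotProduct_smul, smul_eq_mul]
    ring
  have hconn : (graphOf T).Connected := by
    simp only [spanningTrees, mem_filter] at hT
    exact hT.2.2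
  have hconst := eq_of_connected hconn (g := g) (fun s hs => by
    rw [hdot, Finset.sum_eq_single_of_mem s hs fun f _ hfs => by
      rw [edgeVec_dotProduct_componentVec_of_mem i (Finset.mem_erase.mpr ⟨hfs.symm, hs⟩)]
      simp]
    rw [(completesTo_erase hT hs).dotProduct_mul_self i, one_mul, sub_self])
  have he : edgeVec e ⬝ᵥ g = 0 := by rw [edgeVec_dotProduct, hconst e.1 e.2, sub_self]
  rw [hdot, sub_eq_zero] at he
  simpa [Finset.sum_apply] using he

theorem sum_completesTo {p : ℕ} {M : Type*} [AddCommMonoid M] (E : Finset (Fin p × Fin p))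
    (F : Finset (Fin p × Fin p) → Fin p × Fin p → M) (e : Fin p × Fin p) :
    ∑ S ∈ E.powerset with CompletesTo E S e, F S e =
      ∑ T ∈ spanningTrees E with e ∈ T, F (T.erase e) e := by
  refine Finset.sum_bij' (fun S _ => insert e S) (fun T _ => T.erase e) ?_ ?_ ?_ ?_ ?_
  · intro S hS
    exact Finset.mem_filter.mpr ⟨(Finset.mem_filter.mp hS).2.2, Finset.mem_insert_self e S⟩
  · intro T hT
    have h := completesTo_erase (Finset.mem_filter.mp hT).1 (Finset.mem_filter.mp hT).2
    exact Finset.mem_filter.mpr ⟨Finset.mem_powerset.mpr h.subset, h⟩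
  · intro S hS
    exact Finset.erase_insert (Finset.mem_filter.mp hS).2.1
  · intro T hT
    exact Finset.insert_erase (Finset.mem_filter.mp hT).2
  · intro S hS
    simp only [Finset.erase_insert (Finset.mem_filter.mp hS).2.1]

/-- The sum, over the spanning trees through `e`, of the indicators of the side of `e.1`
after removing `e`. It is a potential for the unit current along `e`, scaled by the number
of spanning trees. -/
def treePotential {p : ℕ} (E : Finset (Fin p × Fin p)) (e : Fin p × Fin p) : Fin p → ℝ :=
  ∑ S ∈ E.powerset with CompletesTo E S e, componentVec S e.1

theorem edgeVec_dotProduct_treePotential {p : ℕ} (E : Finset (Fin p × Fin p))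
    (e : Fin p × Fin p) :
    edgeVec e ⬝ᵥ treePotential E e = (((spanningTrees E).filter (fun T => e ∈ T)).card : ℝ) := by
  rw [treePotential, dotProduct_sum,
    Finset.sum_congr rfl fun S hS => (Finset.mem_filter.mp hS).2.dotProduct_fst,
    sum_completesTo E (fun _ _ => (1 : ℝ)) e]
  simp

theorem wlap_mulVec_treePotential {p : ℕ} {E : Finset (Fin p × Fin p)}
    {e : Fin p × Fin p} (he : e ∈ E) :
    wlap E (fun _ => 1) *ᵥ treePotential E e = ((spanningTrees E).card : ℝ) • edgeVec e := by
  have hterm : ∀ f ∈ E, (edgeVec f ⬝ᵥ treePotential E e) • edgeVec f =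
      ∑ S ∈ E.powerset with CompletesTo E S f, ((edgeVec e ⬝ᵥ componentVec S e.1) *
        (edgeVec f ⬝ᵥ componentVec S e.1)) • edgeVec f := fun f hf => by
    rw [treePotential, dotProduct_sum, Finset.sum_smul, Finset.sum_filter, Finset.sum_filter]
    refine Finset.sum_congr rfl fun S _ => ?_
    by_cases hSe : CompletesTo E S e
    · rw [if_pos hSe, hSe.dotProduct_fst, one_mul]
      split_ifs with hSf
      · rfl
      · have : edgeVec f ⬝ᵥ componentVec S e.1 = 0 := by
          by_contra hne
          exact hSf (hSe.exchange hf hne)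
        rw [this, zero_smul]
    · rw [if_neg hSe]
      split_ifs with hSf
      · have : edgeVec e ⬝ᵥ componentVec S e.1 = 0 := by
          by_contra hne
          exact hSe (hSf.exchange he hne)
        rw [this, zero_mul, zero_smul]
      · rfl
  rw [wlap_one_mulVec, Finset.sum_congr rfl hterm]
  rw [Finset.sum_congr rfl fun f _ => sum_completesTo E (fun S f =>
    ((edgeVec e ⬝ᵥ componentVec S e.1) * (edgeVec f ⬝ᵥ componentVec S e.1)) • edgeVec f) f]
  rw [Finset.sum_comm' (t' := spanningTrees E) (s' := id) (fun f T => by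
    simp only [mem_filter, id]
    refine ⟨fun h => ⟨h.2.2, h.2.1⟩, fun h => ⟨?_, h.2, h.1⟩⟩
    have hT := h.2
    simp only [spanningTrees, mem_filter, mem_powerset] at hT
    exact hT.1 h.1)]
  simp only [id]
  rw [Finset.sum_congr rfl fun T hT => sum_spanningTree_smul_edgeVec hT e.1 e,
    Finset.sum_const, Nat.cast_smul_eq_nsmul]

/-- if `P` satisfies the four Moore–Penrose equations for the
unweighted Laplacian `L`, then for every edge `(i,j)`,
`|spt(G)| ⬝ (e_i - e_j)ᵀ P (e_i - e_j) = |{T ∈ spt(G) : (i,j) ∈ T}|`; i.e. the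
effective resistance satisfies `r_{ij} = (e_i - e_j)ᵀ L⁺ (e_i - e_j)`. -/
theorem statement_6 {p : ℕ} (hp : 2 ≤ p) (E : Finset (Fin p × Fin p))
    (hE : ∀ e ∈ E, e.1 < e.2)
    (hconn : (graphOf E).Connected)
    (P : Matrix (Fin p) (Fin p) ℝ)
    (h1 : wlap E (fun _ => 1) * P * wlap E (fun _ => 1) = wlap E (fun _ => 1))
    (h2 : P * wlap E (fun _ => 1) * P = P)
    (h3 : (wlap E (fun _ => 1) * P)ᵀ = wlap E (fun _ => 1) * P)
    (h4 : (P * wlap E (fun _ => 1))ᵀ = P * wlap E (fun _ => 1)) :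
    ∀ e ∈ E,
      ((spanningTrees E).card : ℝ) * (edgeVec e ⬝ᵥ P.mulVec (edgeVec e))
        = (((spanningTrees E).filter (fun T => e ∈ T)).card : ℝ) := by
  intro e he
  rw [← edgeVec_dotProduct_treePotential]
  have hL := wlap_mulVec_treePotential he
  set w := treePotential E e
  set L := wlap E (fun _ => 1) with hLdef
  set N : ℝ := ((spanningTrees E).card : ℝ) with hN
  by_cases hN0 : N = 0
  · have hempty : spanningTrees E = ∅ := by
      rw [← Finset.card_eq_zero]
      exact_mod_cast hN.symm.trans hN0
    rw [edgeVec_dotProduct_treePotential, hempty, hN0]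
    simp
  · have hquad : ∀ x : Fin p → ℝ, w ⬝ᵥ L *ᵥ x = N * (edgeVec e ⬝ᵥ x) := fun x => by
      rw [dotProduct_mulVec, ← mulVec_transpose, transpose_wlap, ← hLdef, hL, smul_dotProduct,
        smul_eq_mul]
    have h := hquad (P *ᵥ L *ᵥ w)
    rw [mulVec_mulVec, mulVec_mulVec, h1, hquad, hL, mulVec_smul,
      dotProduct_smul, smul_eq_mul] at h
    exact (mul_left_cancel₀ hN0 h).symm
end
end

section
/- Let A, B ∈ ℝ^{n×m} have full column rank m (m ≤ n), and let Z_A, Z_B ∈ ℝ^{n×(n−m)} have full column rank with AᵀZ_A = 0 and BᵀZ_B = 0. Assume the m×m matrix BᵀA and the (n−m)×(n−m) matrix Z_AᵀZ_B are invertible. Then I_n − A(BᵀA)⁻¹Bᵀ = Z_B(Z_AᵀZ_B)⁻¹Z_Aᵀ. -/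
open Matrix BigOperators

noncomputable section

/-- for full column rank `A, B ∈ ℝ^{n×m}` with null-space bases
`Z_A, Z_B` (i.e. `AᵀZ_A = 0`, `BᵀZ_B = 0`, full column rank `n - m`), and with
`BᵀA` and `Z_AᵀZ_B` invertible,
`I_n − A(BᵀA)⁻¹Bᵀ = Z_B(Z_AᵀZ_B)⁻¹Z_Aᵀ`. -/
theorem statement_10 {n m : ℕ} (hmn : m ≤ n)
    (A B : Matrix (Fin n) (Fin m) ℝ) (hA : A.rank = m) (hB : B.rank = m)
    (ZA ZB : Matrix (Fin n) (Fin (n - m)) ℝ)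
    (hZA : ZA.rank = n - m) (hZB : ZB.rank = n - m)
    (hAZ : Aᵀ * ZA = 0) (hBZ : Bᵀ * ZB = 0)
    (hBA : IsUnit (Bᵀ * A).det) (hZZ : IsUnit (ZAᵀ * ZB).det) :
    (1 : Matrix (Fin n) (Fin n) ℝ) - A * (Bᵀ * A)⁻¹ * Bᵀ
      = ZB * (ZAᵀ * ZB)⁻¹ * ZAᵀ := by
  have hZA_A : ZAᵀ * A = 0 := by simpa using congrArg transpose hAZ
  have hLR : fromRows ((Bᵀ * A)⁻¹ * Bᵀ) ((ZAᵀ * ZB)⁻¹ * ZAᵀ) * fromCols A ZB = 1 := by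
    rw [fromRows_mul_fromCols]
    simp only [Matrix.mul_assoc, hZA_A, hBZ, Matrix.mul_zero, nonsing_inv_mul _ hBA,
      nonsing_inv_mul _ hZZ, fromBlocks_one]
  have e : Fin m ⊕ Fin (n - m) ≃ Fin n := finSumFinEquiv.trans (finCongr (by omega))
  have hRL := (mul_eq_one_comm_of_equiv e).mp hLR
  rw [fromCols_mul_fromRows] at hRL
  rw [sub_eq_iff_eq_add', Matrix.mul_assoc, Matrix.mul_assoc, hRL]
end
end

section
/- Let S, H ∈ ℝ^{p×p} be symmetric positive semidefinite matrices with ker S ∩ ker H = {0} (equivalently, the columns of S and H together span ℝ^p). Let R ∈ ℝ^{p×k} have full column rank with column space equal to ker S. Then RᵀHR is invertible, and (tS + H)⁻¹ converges to R(RᵀHR)⁻¹Rᵀ as t → ∞ (in particular tS + H is invertible for every t > 0). -/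
open Matrix BigOperators Filter

noncomputable section

/-- A square real matrix whose kernel is trivial has invertible determinant. -/
theorem isUnit_det_of_mulVec_eq_zero {n : ℕ} {M : Matrix (Fin n) (Fin n) ℝ}
    (h : ∀ x : Fin n → ℝ, M *ᵥ x = 0 → x = 0) : IsUnit M.det := by
  rw [isUnit_iff_ne_zero]
  intro hdet
  obtain ⟨v, hv, hMv⟩ := exists_mulVec_eq_zero_iff.mpr hdet
  exact hv (h v hMv)

/-- A real matrix whose rank is its number of columns has trivial kernel. -/
theorem eq_zero_of_mulVec_eq_zero_of_rank_eq {p k : ℕ} {R : Matrix (Fin p) (Fin k) ℝ}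
    (hR : R.rank = k) {y : Fin k → ℝ} (hy : R *ᵥ y = 0) : y = 0 := by
  have hsum := R.mulVecLin.finrank_range_add_finrank_ker
  have hrange : Module.finrank ℝ (LinearMap.range R.mulVecLin) = k := hR
  rw [hrange, Module.finrank_fin_fun] at hsum
  have hbot : LinearMap.ker R.mulVecLin = ⊥ := Submodule.finrank_eq_zero.mp (by omega)
  have hmem : y ∈ LinearMap.ker R.mulVecLin := by simpa using hy
  simpa [hbot] using hmem

/-- If `S * L = 0` and `S * W + H * L = 1`, then `(t • S + H)⁻¹` tends to `L` as `t → ∞`. -/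
theorem tendsto_smul_add_inv {n : ℕ} {S H L W : Matrix (Fin n) (Fin n) ℝ}
    (hSL : S * L = 0) (hW : S * W + H * L = 1) :
    Tendsto (fun t : ℝ => (t • S + H)⁻¹) atTop (nhds L) := by
  have key : ∀ t : ℝ, 0 < t → (t • S + H) * (L + t⁻¹ • W) = 1 + t⁻¹ • (H * W) := by
    intro t ht
    rw [add_mul, mul_add, mul_add, smul_mul_assoc, hSL, smul_mul_smul_comm,
      mul_inv_cancel₀ ht.ne', mul_smul_comm, ← hW]
    simp only [smul_zero, one_smul]
    abel
  have hinv : Tendsto (fun t : ℝ => t⁻¹) atTop (nhds 0) := tendsto_inv_atTop_zero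
  have hN : Tendsto (fun t : ℝ => 1 + t⁻¹ • (H * W)) atTop (nhds 1) := by
    simpa using (hinv.smul_const (H * W)).const_add 1
  have hL : Tendsto (fun t : ℝ => L + t⁻¹ • W) atTop (nhds L) := by
    simpa using (hinv.smul_const W).const_add L
  have hNdet : Tendsto (fun t : ℝ => (1 + t⁻¹ • (H * W)).det) atTop (nhds 1) := by
    simpa [Function.comp_def] using (continuous_id.matrix_det.tendsto (1 : Matrix (Fin n) (Fin n) ℝ)).comp hN
  have hNinv : Tendsto (fun t : ℝ => (1 + t⁻¹ • (H * W))⁻¹) atTop (nhds 1) := by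
    have hadj : Tendsto (fun t : ℝ => (1 + t⁻¹ • (H * W)).adjugate) atTop (nhds 1) := by
      simpa [Function.comp_def] using (continuous_id.matrix_adjugate.tendsto (1 : Matrix (Fin n) (Fin n) ℝ)).comp hN
    simpa [Matrix.inv_def, Ring.inverse_eq_inv'] using (hNdet.inv₀ one_ne_zero).smul hadj
  have hprod := hL.mul hNinv
  rw [mul_one] at hprod
  refine hprod.congr' ?_
  filter_upwards [eventually_gt_atTop 0, hNdet.eventually_ne one_ne_zero] with t ht hne
  symm
  apply Matrix.inv_eq_right_inv
  rw [← mul_assoc, key t ht, Matrix.mul_nonsing_inv _ (isUnit_iff_ne_zero.mpr hne)]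

/-- for symmetric PSD `S, H` with `ker S ∩ ker H = {0}` and `R` of
full column rank whose column space equals `ker S`, the matrix `RᵀHR` is
invertible, `tS + H` is invertible for every `t > 0`, and
`(tS + H)⁻¹ → R(RᵀHR)⁻¹Rᵀ` as `t → ∞`. -/
theorem statement_11 {p k : ℕ}
    (S H : Matrix (Fin p) (Fin p) ℝ)
    (hS : S.PosSemidef) (hH : H.PosSemidef)
    (hker : ∀ x : Fin p → ℝ, S.mulVec x = 0 → H.mulVec x = 0 → x = 0)
    (R : Matrix (Fin p) (Fin k) ℝ) (hR : R.rank = k)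
    (hcol : ∀ x : Fin p → ℝ, S.mulVec x = 0 ↔ ∃ y : Fin k → ℝ, R.mulVec y = x) :
    IsUnit (Rᵀ * H * R).det ∧
    (∀ t : ℝ, 0 < t → IsUnit (t • S + H).det) ∧
    Tendsto (fun t : ℝ => (t • S + H)⁻¹) atTop
      (nhds (R * (Rᵀ * H * R)⁻¹ * Rᵀ)) := by
  have hSR : S * R = 0 := by
    apply Matrix.ext_of_mulVec_single
    intro i
    rw [← mulVec_mulVec, (hcol _).mpr ⟨_, rfl⟩, zero_mulVec]
  have hGdet : IsUnit (Rᵀ * H * R).det := by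
    refine isUnit_det_of_mulVec_eq_zero fun y hy => ?_
    refine eq_zero_of_mulVec_eq_zero_of_rank_eq hR (hker _ ((hcol _).mpr ⟨y, rfl⟩) ?_)
    rw [← hH.dotProduct_mulVec_zero_iff, star_trivial, ← vecMul_transpose, ← dotProduct_mulVec,
      vecMul_transpose, mulVec_mulVec, mulVec_mulVec, hy, dotProduct_zero]
  have hAdet : ∀ t : ℝ, 0 < t → IsUnit (t • S + H).det := by
    refine fun t ht => isUnit_det_of_mulVec_eq_zero fun x hx => ?_
    have hsum : t * (x ⬝ᵥ S *ᵥ x) + x ⬝ᵥ H *ᵥ x = 0 := by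
      have := congrArg (x ⬝ᵥ ·) hx
      simpa [add_mulVec, smul_mulVec, dotProduct_add] using this
    have hSx : 0 ≤ x ⬝ᵥ S *ᵥ x := by simpa using hS.dotProduct_mulVec_nonneg x
    have hHx : 0 ≤ x ⬝ᵥ H *ᵥ x := by simpa using hH.dotProduct_mulVec_nonneg x
    have htS := mul_nonneg ht.le hSx
    have hS0 : t * (x ⬝ᵥ S *ᵥ x) = 0 := by linarith
    refine hker x ((hS.dotProduct_mulVec_zero_iff x).mp ?_)
      ((hH.dotProduct_mulVec_zero_iff x).mp ?_)
    · simpa [ht.ne'] using hS0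
    · rw [star_trivial]
      linarith
  refine ⟨hGdet, hAdet, ?_⟩
  have hSt : Sᵀ = S := by simpa using hS.isHermitian.eq
  have hRS : Rᵀ * S = 0 := by
    rw [← hSt, ← transpose_mul, hSR, transpose_zero]
  set G := Rᵀ * H * R with hG
  set L := R * G⁻¹ * Rᵀ with hLdef
  have hSL : S * L = 0 := by
    rw [hLdef, ← Matrix.mul_assoc, ← Matrix.mul_assoc, hSR, Matrix.zero_mul, Matrix.zero_mul]
  have hLS : L * S = 0 := by
    rw [hLdef, Matrix.mul_assoc, hRS, Matrix.mul_zero]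
  have hLHR : L * H * R = R := by
    calc L * H * R = R * (G⁻¹ * G) := by simp only [hLdef, hG, Matrix.mul_assoc]
      _ = R := by rw [nonsing_inv_mul _ hGdet, Matrix.mul_one]
  have hLHL : L * H * L = L := by
    calc L * H * L = L * H * R * G⁻¹ * Rᵀ := by simp only [hLdef, Matrix.mul_assoc]
      _ = L := by rw [hLHR]
  have hLM : L * (S + H * L * H) = L * H := by
    rw [mul_add, hLS, zero_add, ← Matrix.mul_assoc, ← Matrix.mul_assoc, hLHL]
  have hMdet : IsUnit (S + H * L * H).det := by
    refine isUnit_det_of_mulVec_eq_zero fun x hx => ?_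
    have hLHx : (L * H) *ᵥ x = 0 := by
      rw [← hLM, ← mulVec_mulVec, hx, mulVec_zero]
    have hSx : S *ᵥ x = 0 := by
      rwa [add_mulVec, Matrix.mul_assoc, ← mulVec_mulVec, hLHx, mulVec_zero, add_zero] at hx
    obtain ⟨y, rfl⟩ := (hcol x).mp hSx
    rwa [mulVec_mulVec, hLHR] at hLHx
  set M := S + H * L * H with hM
  have hLHM : L * H * M⁻¹ = L := by
    rw [← hLM, Matrix.mul_assoc, mul_nonsing_inv _ hMdet, Matrix.mul_one]
  refine tendsto_smul_add_inv (W := M⁻¹ * (1 - H * L)) hSL ?_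
  have hSM : S = M - H * L * H := by rw [hM, add_sub_cancel_right]
  have hcorr : H * L * H * (M⁻¹ * (1 - H * L)) = 0 := by
    calc H * L * H * (M⁻¹ * (1 - H * L)) = H * (L * H * M⁻¹) * (1 - H * L) := by
          simp only [Matrix.mul_assoc]
      _ = H * (L - L * H * L) := by
          rw [hLHM, Matrix.mul_assoc, mul_sub, Matrix.mul_one, Matrix.mul_assoc L]
      _ = 0 := by rw [hLHL, sub_self, Matrix.mul_zero]
  rw [hSM, sub_mul, hcorr, sub_zero, ← Matrix.mul_assoc, mul_nonsing_inv _ hMdet, one_mul,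
    sub_add_cancel]
end
end

section
/- Let w ∈ ℝ^p with 1_pᵀw ≠ 0, and let U, V ∈ ℝ^{p×(p−1)} have orthonormal columns with Uᵀ1_p = 0 and Vᵀw = 0. Then the (p−1)×(p−1) matrix VᵀU is invertible and I_p − U(VᵀU)⁻¹Vᵀ = (1/(1_pᵀw)) · w 1_pᵀ. -/
open Matrix BigOperators

noncomputable section

/-- If `L * R = 1` with `R` of corank one, `L` kills `a` and `b` annihilates `R` from the left,
then `R * L` is the projection along `a` onto the hyperplane annihilated by `b`. -/
theorem mul_eq_one_sub_smul_vecMulVec {ι κ K : Type*} [Fintype ι] [Fintype κ] [DecidableEq ι]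
    [DecidableEq κ] [Field K] (hcard : Fintype.card ι = Fintype.card κ + 1)
    (L : Matrix κ ι K) (R : Matrix ι κ K) (a b : ι → K) (hLR : L * R = 1)
    (hLa : L *ᵥ a = 0) (hbR : b ᵥ* R = 0) (hba : b ⬝ᵥ a ≠ 0) :
    R * L = 1 - (b ⬝ᵥ a)⁻¹ • vecMulVec a b := by
  have e : ι ≃ κ ⊕ Unit := Fintype.equivOfCardEq (by simp [hcard])
  have hblock : fromRows L (replicateRow Unit b) *
      fromCols R (replicateCol Unit ((b ⬝ᵥ a)⁻¹ • a)) = 1 := by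
    rw [fromRows_mul_fromCols, hLR, ← replicateCol_mulVec, ← replicateRow_vecMul, hbR,
      mulVec_smul, hLa, ← fromBlocks_one]
    congr 1
    · ext; simp
    · ext i j
      simp [Matrix.mul_apply, dotProduct] at hba ⊢
      simp only [mul_left_comm _ (_)⁻¹, ← Finset.mul_sum]
      exact inv_mul_cancel₀ hba
  rw [mul_eq_one_comm_of_equiv e.symm, fromCols_mul_fromRows] at hblock
  rw [eq_sub_iff_add_eq, ← hblock, ← smul_vecMulVec, vecMulVec_eq Unit]

/-- for `w` with `1ᵀw ≠ 0` and orthonormal `U, V ∈ ℝ^{p×(p−1)}` with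
`Uᵀ1 = 0` and `Vᵀw = 0`, the matrix `VᵀU` is invertible and
`I_p − U(VᵀU)⁻¹Vᵀ = (1/(1ᵀw)) w 1ᵀ`. -/
theorem statement_12 {p : ℕ} (w : Fin p → ℝ) (hw : (∑ i, w i) ≠ 0)
    (U V : Matrix (Fin p) (Fin (p - 1)) ℝ)
    (hU : Uᵀ * U = 1) (hV : Vᵀ * V = 1)
    (hU1 : Uᵀ.mulVec (fun _ => 1) = 0) (hVw : Vᵀ.mulVec w = 0) :
    IsUnit (Vᵀ * U).det ∧
    (1 : Matrix (Fin p) (Fin p) ℝ) - U * (Vᵀ * U)⁻¹ * Vᵀ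
      = (∑ i, w i)⁻¹ • Matrix.vecMulVec w (fun _ => 1) := by
  have hcard : Fintype.card (Fin p) = Fintype.card (Fin (p - 1)) + 1 := by
    rcases p with _ | p
    · simp at hw
    · simp
  have hp : (p : ℝ) ≠ 0 := by
    rintro h
    obtain rfl : p = 0 := by exact_mod_cast h
    simp at hw
  have h1U : (fun _ => 1) ᵥ* U = 0 := by rw [← mulVec_transpose]; exact hU1
  have h1w : (fun _ => 1) ⬝ᵥ w = ∑ i, w i := by simp [dotProduct]
  have hUU := mul_eq_one_sub_smul_vecMulVec hcard Uᵀ U (fun _ => 1) (fun _ => 1) hU hU1 h1U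
    (by simpa [dotProduct] using hp)
  set Q : Matrix (Fin p) (Fin p) ℝ := 1 - (∑ i, w i)⁻¹ • vecMulVec w (fun _ => 1) with hQ
  have h1Q : (fun _ => 1) ᵥ* Q = 0 := by
    rw [hQ, vecMul_sub, vecMul_one, vecMul_smul, vecMul_vecMulVec, h1w, smul_smul,
      inv_mul_cancel₀ hw, one_smul, sub_self]
  have hVQ : Vᵀ * Q = Vᵀ := by
    rw [hQ, Matrix.mul_sub, Matrix.mul_smul, mul_vecMulVec, hVw]
    simp
  have hinv : (Vᵀ * U) * (Uᵀ * Q * V) = 1 := by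
    calc (Vᵀ * U) * (Uᵀ * Q * V) = Vᵀ * ((U * Uᵀ) * Q) * V := by simp only [Matrix.mul_assoc]
      _ = Vᵀ * Q * V := by
        rw [hUU, Matrix.sub_mul, Matrix.smul_mul, vecMulVec_mul, h1Q]
        simp
      _ = 1 := by rw [hVQ, hV]
  have hunit : IsUnit (Vᵀ * U).det := isUnit_det_of_right_inverse hinv
  refine ⟨hunit, ?_⟩
  rw [mul_eq_one_sub_smul_vecMulVec hcard Vᵀ (U * (Vᵀ * U)⁻¹) w (fun _ => 1) ?_ hVw ?_
    (h1w ▸ hw), h1w, sub_sub_cancel]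
  · rw [← Matrix.mul_assoc, mul_nonsing_inv _ hunit]
  · rw [← vecMul_vecMul, h1U, zero_vecMul]
end
end

section
/- Let w ∈ ℝ^p be nonzero with 1_pᵀw ≠ 0, and let U, V ∈ ℝ^{p×(p−1)} have orthonormal columns with Uᵀ1_p = 0 and Vᵀw = 0. Then (det(VᵀU))² = (1_pᵀw)² / (p · ‖w‖²). -/
open Matrix BigOperators

noncomputable section

/-- If `m` and `n` have the same cardinality, the Gram-type determinant `det (Xᵀ * Y)` factors. -/
theorem det_transpose_mul_of_equiv {m n : Type*} [Fintype m] [Fintype n] [DecidableEq n]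
    (e : n ≃ m) (X Y : Matrix m n ℝ) :
    (Xᵀ * Y).det = (X.submatrix e id).det * (Y.submatrix e id).det := by
  rw [← det_transpose (X.submatrix e id), ← det_mul, transpose_submatrix, submatrix_mul_equiv,
    submatrix_id_id]

/-- Transpose-product of two matrices, each enlarged by one extra column. -/
theorem transpose_fromCols_replicateCol_mul {m n : Type*} [Fintype m]
    (X Y : Matrix m n ℝ) (x y : m → ℝ) :
    (fromCols X (replicateCol Unit x))ᵀ * fromCols Y (replicateCol Unit y) =
      fromBlocks (Xᵀ * Y) (replicateCol Unit (Xᵀ *ᵥ y))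
        (replicateRow Unit (Yᵀ *ᵥ x)) (of fun _ _ => x ⬝ᵥ y) := by
  rw [transpose_fromCols, fromRows_mul_fromCols]
  congr 1
  ext i j
  simp [mul_apply, mulVec, dotProduct, mul_comm]

/-- The determinant of the transpose-product of two matrices with an extra column,
when the extra column on the right is orthogonal to the columns on the left. -/
theorem det_transpose_fromCols_mul_of_left {m n : Type*} [Fintype m] [Fintype n] [DecidableEq n]
    (X Y : Matrix m n ℝ) (x y : m → ℝ) (h : Xᵀ *ᵥ y = 0) :
    ((fromCols X (replicateCol Unit x))ᵀ * fromCols Y (replicateCol Unit y)).det =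
      (Xᵀ * Y).det * (x ⬝ᵥ y) := by
  rw [transpose_fromCols_replicateCol_mul, h, replicateCol_zero, det_fromBlocks_zero₁₂]
  simp

/-- The determinant of the transpose-product of two matrices with an extra column,
when the extra column on the left is orthogonal to the columns on the right. -/
theorem det_transpose_fromCols_mul_of_right {m n : Type*} [Fintype m] [Fintype n] [DecidableEq n]
    (X Y : Matrix m n ℝ) (x y : m → ℝ) (h : Yᵀ *ᵥ x = 0) :
    ((fromCols X (replicateCol Unit x))ᵀ * fromCols Y (replicateCol Unit y)).det =
      (Xᵀ * Y).det * (x ⬝ᵥ y) := by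
  rw [transpose_fromCols_replicateCol_mul, h, replicateRow_zero, det_fromBlocks_zero₂₁]
  simp

/-- for nonzero `w` with `1ᵀw ≠ 0` and orthonormal
`U, V ∈ ℝ^{p×(p−1)}` with `Uᵀ1 = 0` and `Vᵀw = 0`,
`(det(VᵀU))² = (1ᵀw)² / (p‖w‖²)`. -/
theorem statement_13 {p : ℕ} (w : Fin p → ℝ) (hw0 : w ≠ 0) (hw : (∑ i, w i) ≠ 0)
    (U V : Matrix (Fin p) (Fin (p - 1)) ℝ)
    (hU : Uᵀ * U = 1) (hV : Vᵀ * V = 1)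
    (hU1 : Uᵀ.mulVec (fun _ => 1) = 0) (hVw : Vᵀ.mulVec w = 0) :
    (Vᵀ * U).det ^ 2 = (∑ i, w i) ^ 2 / ((p : ℝ) * ∑ i, (w i) ^ 2) := by
  have hp : p ≠ 0 := by
    rintro rfl
    simp at hw
  have hN : w ⬝ᵥ w ≠ 0 := by rwa [ne_eq, dotProduct_self_eq_zero]
  have hsq : ∑ i, w i ^ 2 = w ⬝ᵥ w := by simp [dotProduct, sq]
  have hsum : ∑ i, w i = (fun _ => 1) ⬝ᵥ w := by simp [dotProduct]
  have hone : (fun _ => 1 : Fin p → ℝ) ⬝ᵥ (fun _ => 1) = p := by simp [dotProduct]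
  let e : Fin (p - 1) ⊕ Unit ≃ Fin p := Fintype.equivOfCardEq (by simp; omega)
  have hUU := det_transpose_fromCols_mul_of_left U U (fun _ => 1) _ hU1
  have hVV := det_transpose_fromCols_mul_of_left V V w w hVw
  have hUw := det_transpose_fromCols_mul_of_right U U (fun _ => 1) w hU1
  have hVU := det_transpose_fromCols_mul_of_left V U w w hVw
  rw [det_transpose_mul_of_equiv e] at hUU hVV hUw hVU
  rw [hU, det_one, one_mul] at hUU hUw
  rw [hV, det_one, one_mul] at hVV
  rw [hone] at hUU
  rw [hsq, hsum, eq_div_iff (by simp [hp, hN]), ← hUw]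
  apply mul_right_cancel₀ hN
  rw [← hUU]
  generalize ((fromCols U (replicateCol Unit fun _ => (1 : ℝ))).submatrix e id).det = a at *
  generalize ((fromCols V (replicateCol Unit w)).submatrix e id).det = b at *
  generalize ((fromCols U (replicateCol Unit w)).submatrix e id).det = c at *
  generalize (Vᵀ * U).det = d at *
  generalize w ⬝ᵥ w = N at *
  linear_combination a ^ 2 * c ^ 2 * hVV - a ^ 2 * (b * c + d * N) * hVU
end
end

section
/- (Covariance limit in Proposition 2.) Let Φ, Ψ ∈ ℝ^{p×p} be symmetric positive semidefinite with ker Φ ∩ ker Ψ ∩ {x : wᵀx = 0} = {0}, where w ∈ ℝ^p. Let Z ∈ ℝ^{p×s} have full column rank with column space equal to ker Φ, and assume Zᵀw ≠ 0. Let V ∈ ℝ^{p×(p−1)} have full column rank with Vᵀw = 0, and let Ṽ ∈ ℝ^{s×(s−1)} have full column rank with Ṽᵀ(Zᵀw) = 0. Fix v1 > 0. Then for every v0 > 0 the matrix v0⁻¹VᵀΦV + v1⁻¹VᵀΨV is invertible, the matrix ṼᵀZᵀΨZṼ is invertible, and V(v0⁻¹VᵀΦV + v1⁻¹VᵀΨV)⁻¹Vᵀ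 converges to v1 · ZṼ(ṼᵀZᵀΨZṼ)⁻¹ṼᵀZᵀ as v0 → 0⁺. -/
open Matrix BigOperators Filter

noncomputable section

/-- If `N * M = 0` and the ranks of `M` and `N` add up to at least the middle dimension, then
every vector in the kernel of `N` lies in the range of `M`. -/
theorem exists_mulVec_eq_of_mul_eq_zero {l m n : ℕ} (M : Matrix (Fin n) (Fin m) ℝ)
    (N : Matrix (Fin l) (Fin n) ℝ) (h : N * M = 0) (hr : n ≤ M.rank + N.rank)
    {x : Fin n → ℝ} (hx : N *ᵥ x = 0) : ∃ y, M *ᵥ y = x := by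
  have hle : LinearMap.range M.mulVecLin ≤ LinearMap.ker N.mulVecLin := by
    rintro _ ⟨y, rfl⟩
    simp [h]
  have hdim := LinearMap.finrank_range_add_finrank_ker N.mulVecLin
  rw [Module.finrank_fin_fun] at hdim
  unfold Matrix.rank at hr
  have heq := Submodule.eq_of_le_of_finrank_le hle (by omega)
  have hmem : x ∈ LinearMap.range M.mulVecLin := by
    rw [heq]
    simpa using hx
  simpa using hmem

theorem exists_mulVec_eq_of_dotProduct_eq_zero {n : ℕ} (M : Matrix (Fin n) (Fin (n - 1)) ℝ)
    (hM : M.rank = n - 1) {w : Fin n → ℝ} (hw : w ≠ 0) (hMw : Mᵀ *ᵥ w = 0)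
    {x : Fin n → ℝ} (hx : w ⬝ᵥ x = 0) : ∃ y, M *ᵥ y = x := by
  refine exists_mulVec_eq_of_mul_eq_zero M (Matrix.of fun _ : Fin 1 => w) ?_ ?_ ?_
  · ext i j
    simpa [Matrix.mul_apply, Matrix.mulVec, dotProduct, mul_comm] using congrFun hMw j
  · have : (Matrix.of fun _ : Fin 1 => w).rank ≠ 0 := by
      intro h
      have h0 := LinearMap.range_eq_bot.mp (Submodule.finrank_eq_zero.mp h)
      have hww : w ⬝ᵥ w = 0 := congrFun (LinearMap.congr_fun h0 w) 0
      exact hw (dotProduct_self_eq_zero.mp hww)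
    omega
  · ext i
    simpa [Matrix.mulVec] using hx

theorem mulVec_injective_of_rank_eq {m n : ℕ} (M : Matrix (Fin m) (Fin n) ℝ) (h : M.rank = n) :
    Function.Injective M.mulVec := by
  have hdim := LinearMap.finrank_range_add_finrank_ker M.mulVecLin
  rw [Module.finrank_fin_fun] at hdim
  unfold Matrix.rank at h
  have hk : LinearMap.ker M.mulVecLin = ⊥ := Submodule.finrank_eq_zero.mp (by omega)
  exact LinearMap.ker_eq_bot.mp hk

theorem exists_mul_eq_of_forall_mulVec {l m n : ℕ} (M : Matrix (Fin n) (Fin m) ℝ)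
    (N : Matrix (Fin n) (Fin l) ℝ) (h : ∀ y, ∃ x, M *ᵥ x = N *ᵥ y) :
    ∃ X : Matrix (Fin m) (Fin l) ℝ, M * X = N := by
  choose f hf using fun j => h (Pi.single j 1)
  refine ⟨(Matrix.of f)ᵀ, ?_⟩
  refine Matrix.ext_of_mulVec_single fun j => ?_
  rw [← hf j, ← Matrix.mulVec_mulVec, Matrix.mulVec_single_one]
  rfl

theorem isUnit_det_of_forall_mulVec {n : ℕ} {M : Matrix (Fin n) (Fin n) ℝ}
    (h : ∀ x, M *ᵥ x = 0 → x = 0) : IsUnit M.det := by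
  rw [← Matrix.isUnit_iff_isUnit_det, ← Matrix.mulVec_injective_iff_isUnit]
  exact (injective_iff_map_eq_zero M.mulVecLin).mpr h

theorem PosSemidef.mulVec_eq_zero_of_add {n : ℕ} {A B : Matrix (Fin n) (Fin n) ℝ}
    (hA : A.PosSemidef) (hB : B.PosSemidef) {x : Fin n → ℝ} (h : (A + B) *ᵥ x = 0) :
    A *ᵥ x = 0 ∧ B *ᵥ x = 0 := by
  have h0 : star x ⬝ᵥ (A *ᵥ x) + star x ⬝ᵥ (B *ᵥ x) = 0 := by
    rw [← dotProduct_add, ← Matrix.add_mulVec, h, dotProduct_zero]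
  have h1 := hA.dotProduct_mulVec_nonneg x
  have h2 := hB.dotProduct_mulVec_nonneg x
  exact ⟨(hA.dotProduct_mulVec_zero_iff x).mp (by linarith),
    (hB.dotProduct_mulVec_zero_iff x).mp (by linarith)⟩

theorem PosSemidef.mulVec_eq_zero_of_conj {m n : ℕ} {A : Matrix (Fin n) (Fin n) ℝ}
    (hA : A.PosSemidef) (V : Matrix (Fin n) (Fin m) ℝ) {x : Fin m → ℝ}
    (h : (Vᵀ * A * V) *ᵥ x = 0) : A *ᵥ (V *ᵥ x) = 0 := by
  refine (hA.dotProduct_mulVec_zero_iff _).mp ?_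
  have h0 : x ⬝ᵥ ((Vᵀ * A * V) *ᵥ x) = 0 := by rw [h, dotProduct_zero]
  rw [← Matrix.mulVec_mulVec, ← Matrix.mulVec_mulVec, Matrix.dotProduct_mulVec,
    Matrix.vecMul_transpose] at h0
  simpa using h0

/-- If `M ε * (P + ε • Y) = 1 + ε • E` for small `ε > 0`, then `(M ε)⁻¹` converges to `P`. -/
theorem tendsto_inv_of_mul_eq_one_add {n : ℕ} {M : ℝ → Matrix (Fin n) (Fin n) ℝ}
    {P Y E : Matrix (Fin n) (Fin n) ℝ}
    (h : ∀ ε, 0 < ε → M ε * (P + ε • Y) = 1 + ε • E) :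
    Tendsto (fun ε => (M ε)⁻¹) (nhdsWithin 0 (Set.Ioi 0)) (nhds P) := by
  have hc : Continuous fun ε : ℝ => (1 + ε • E) := by fun_prop
  have hdet : ∀ᶠ ε : ℝ in nhds 0, (1 + ε • E).det ≠ 0 := by
    refine hc.matrix_det.continuousAt.eventually_ne ?_
    simp
  have hinv : ContinuousAt (fun ε : ℝ => (1 + ε • E)⁻¹) 0 := by
    simp only [Matrix.inv_def, Ring.inverse_eq_inv']
    exact (hc.matrix_det.continuousAt.inv₀ (by simp)).smul hc.matrix_adjugate.continuousAt
  have hlim : ContinuousAt (fun ε : ℝ => (P + ε • Y) * (1 + ε • E)⁻¹) 0 := by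
    have hP : ContinuousAt (fun ε : ℝ => P + ε • Y) 0 := by fun_prop
    exact (continuous_fst.matrix_mul continuous_snd).continuousAt.comp (hP.prodMk hinv)
  have hlim' := hlim.tendsto.mono_left (nhdsWithin_le_nhds (s := Set.Ioi 0))
  simp only [zero_smul, add_zero, inv_one, mul_one] at hlim'
  refine hlim'.congr' ?_
  filter_upwards [self_mem_nhdsWithin, nhdsWithin_le_nhds hdet] with ε hε hd
  refine (Matrix.inv_eq_right_inv ?_).symm
  rw [← Matrix.mul_assoc, h ε hε, Matrix.mul_nonsing_inv _ (isUnit_iff_ne_zero.mpr hd)]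

/-- The limit of `(ε⁻¹ • A + c⁻¹ • B)⁻¹` as `ε → 0⁺`, where the columns of `U` form a basis
of `ker A`. -/
theorem tendsto_inv_smul_add_smul {k n : ℕ} {A B : Matrix (Fin n) (Fin n) ℝ}
    (hA : A.IsHermitian) (U : Matrix (Fin n) (Fin k) ℝ)
    (hAU : ∀ x, A *ᵥ x = 0 ↔ ∃ y, U *ᵥ y = x) (hUBU : IsUnit (Uᵀ * B * U).det)
    {c : ℝ} (hc : c ≠ 0) :
    Tendsto (fun ε : ℝ => (ε⁻¹ • A + c⁻¹ • B)⁻¹) (nhdsWithin 0 (Set.Ioi 0))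
      (nhds (c • (U * (Uᵀ * B * U)⁻¹ * Uᵀ))) := by
  have hAU0 : A * U = 0 := by
    refine Matrix.ext_of_mulVec_single fun j => ?_
    rw [← Matrix.mulVec_mulVec, (hAU _).mpr ⟨_, rfl⟩, Matrix.zero_mulVec]
  have hUA0 : Uᵀ * A = 0 := by
    have hAt : Aᵀ = A := by simpa [Matrix.IsHermitian] using hA
    simpa [hAt] using congrArg Matrix.transpose hAU0
  have hrank : n ≤ A.rank + Uᵀ.rank := by
    have hdim := LinearMap.finrank_range_add_finrank_ker A.mulVecLin
    have hk : LinearMap.ker A.mulVecLin = LinearMap.range U.mulVecLin := by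
      ext x
      simpa using hAU x
    rw [Module.finrank_fin_fun, hk] at hdim
    rw [Matrix.rank_transpose]
    exact hdim.ge
  set G := (Uᵀ * B * U)⁻¹ with hG
  have hproj : Uᵀ * (1 - B * U * G * Uᵀ) = 0 := by
    have : Uᵀ * (B * U * G * Uᵀ) = (Uᵀ * B * U) * G * Uᵀ := by simp only [Matrix.mul_assoc]
    rw [Matrix.mul_sub, this, hG, Matrix.mul_nonsing_inv _ hUBU, Matrix.one_mul,
      Matrix.mul_one, sub_self]
  obtain ⟨Y, hY⟩ := exists_mul_eq_of_forall_mulVec A (1 - B * U * G * Uᵀ) fun y =>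
    exists_mulVec_eq_of_mul_eq_zero A Uᵀ hUA0 hrank (by
      rw [Matrix.mulVec_mulVec, hproj, Matrix.zero_mulVec])
  refine tendsto_inv_of_mul_eq_one_add (Y := Y) (E := c⁻¹ • (B * Y)) fun ε hε => ?_
  have hAP : A * (U * G * Uᵀ) = 0 := by
    rw [← Matrix.mul_assoc, ← Matrix.mul_assoc, hAU0, Matrix.zero_mul, Matrix.zero_mul]
  have hBP : B * (U * G * Uᵀ) = B * U * G * Uᵀ := by simp only [Matrix.mul_assoc]
  rw [Matrix.add_mul, Matrix.mul_add, Matrix.mul_add]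
  simp only [Matrix.smul_mul, Matrix.mul_smul, hAP, hBP, hY, smul_zero, smul_inv_smul₀ hc,
    smul_inv_smul₀ hε.ne', smul_comm ε c⁻¹]
  abel

/-- covariance limit in Proposition 2: with `Φ, Ψ` symmetric PSD,
`ker Φ ∩ ker Ψ ∩ {x : wᵀx = 0} = {0}`, `Z` a full-column-rank basis of `ker Φ`
with `Zᵀw ≠ 0`, `V` of full column rank with `Vᵀw = 0`, `Ṽ` of full column rank
with `Ṽᵀ(Zᵀw) = 0`, and `v1 > 0`: for each `v0 > 0` the matrix
`v0⁻¹VᵀΦV + v1⁻¹VᵀΨV` is invertible, `ṼᵀZᵀΨZṼ` is invertible, and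
`V(v0⁻¹VᵀΦV + v1⁻¹VᵀΨV)⁻¹Vᵀ → v1 ⬝ ZṼ(ṼᵀZᵀΨZṼ)⁻¹ṼᵀZᵀ` as `v0 → 0⁺`. -/
theorem statement_15 {p s : ℕ}
    (Φ Ψ : Matrix (Fin p) (Fin p) ℝ)
    (hΦ : Φ.PosSemidef) (hΨ : Ψ.PosSemidef)
    (w : Fin p → ℝ)
    (hker : ∀ x : Fin p → ℝ, Φ.mulVec x = 0 → Ψ.mulVec x = 0 → w ⬝ᵥ x = 0 → x = 0)
    (Z : Matrix (Fin p) (Fin s) ℝ) (hZrank : Z.rank = s)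
    (hZcol : ∀ x : Fin p → ℝ, Φ.mulVec x = 0 ↔ ∃ y : Fin s → ℝ, Z.mulVec y = x)
    (hZw : Zᵀ.mulVec w ≠ 0)
    (V : Matrix (Fin p) (Fin (p - 1)) ℝ) (hVrank : V.rank = p - 1)
    (hVw : Vᵀ.mulVec w = 0)
    (W : Matrix (Fin s) (Fin (s - 1)) ℝ) (hWrank : W.rank = s - 1)
    (hWw : Wᵀ.mulVec (Zᵀ.mulVec w) = 0)
    (v1 : ℝ) (hv1 : 0 < v1) :
    (∀ v0 : ℝ, 0 < v0 →
      IsUnit (v0⁻¹ • (Vᵀ * Φ * V) + v1⁻¹ • (Vᵀ * Ψ * V)).det) ∧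
    IsUnit (Wᵀ * Zᵀ * Ψ * Z * W).det ∧
    Tendsto
      (fun v0 : ℝ => V * (v0⁻¹ • (Vᵀ * Φ * V) + v1⁻¹ • (Vᵀ * Ψ * V))⁻¹ * Vᵀ)
      (nhdsWithin 0 (Set.Ioi 0))
      (nhds (v1 • (Z * W * (Wᵀ * Zᵀ * Ψ * Z * W)⁻¹ * (Z * W)ᵀ))) := by
  have hw : w ≠ 0 := fun h => hZw (by rw [h, Matrix.mulVec_zero])
  have hVinj := mulVec_injective_of_rank_eq V hVrank
  have hZinj := mulVec_injective_of_rank_eq Z hZrank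
  have hWinj := mulVec_injective_of_rank_eq W hWrank
  have hwV : ∀ x, w ⬝ᵥ V *ᵥ x = 0 := fun x => by
    rw [Matrix.dotProduct_mulVec, ← Matrix.mulVec_transpose, hVw, zero_dotProduct]
  have hwZ : ∀ y, w ⬝ᵥ Z *ᵥ y = (Zᵀ *ᵥ w) ⬝ᵥ y := fun y => by
    rw [Matrix.dotProduct_mulVec, ← Matrix.mulVec_transpose]
  have hwZW : ∀ y, w ⬝ᵥ Z *ᵥ W *ᵥ y = 0 := fun y => by
    rw [hwZ, Matrix.dotProduct_mulVec, ← Matrix.mulVec_transpose, hWw, zero_dotProduct]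
  have hVΦV : (Vᵀ * Φ * V).PosSemidef := by
    simpa using hΦ.conjTranspose_mul_mul_same V
  have hVΨV : (Vᵀ * Ψ * V).PosSemidef := by
    simpa using hΨ.conjTranspose_mul_mul_same V
  have hΦZ : ∀ y, Φ *ᵥ (Z *ᵥ y) = 0 := fun y => (hZcol _).mpr ⟨y, rfl⟩
  obtain ⟨U, hU⟩ := exists_mul_eq_of_forall_mulVec V (Z * W) fun y =>
    exists_mulVec_eq_of_dotProduct_eq_zero V hVrank hw hVw (by
      rw [← Matrix.mulVec_mulVec]; exact hwZW y)
  have hVU : ∀ y, V *ᵥ U *ᵥ y = Z *ᵥ W *ᵥ y := fun y => by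
    rw [Matrix.mulVec_mulVec, hU, Matrix.mulVec_mulVec]
  have hkerU : ∀ x, (Vᵀ * Φ * V) *ᵥ x = 0 ↔ ∃ y, U *ᵥ y = x := by
    intro x
    constructor
    · intro hx
      obtain ⟨y, hy⟩ := (hZcol _).mp (PosSemidef.mulVec_eq_zero_of_conj hΦ V hx)
      obtain ⟨z, hz⟩ := exists_mulVec_eq_of_dotProduct_eq_zero W hWrank hZw hWw
        (x := y) (by rw [← hwZ, hy, hwV])
      exact ⟨z, hVinj (by rw [hVU, hz, hy])⟩
    · rintro ⟨y, rfl⟩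
      rw [← Matrix.mulVec_mulVec, ← Matrix.mulVec_mulVec, hVU, hΦZ, Matrix.mulVec_zero]
  have hconj : Wᵀ * Zᵀ * Ψ * Z * W = Uᵀ * (Vᵀ * Ψ * V) * U := by
    calc Wᵀ * Zᵀ * Ψ * Z * W = (Z * W)ᵀ * Ψ * (Z * W) := by
          simp only [Matrix.transpose_mul, Matrix.mul_assoc]
      _ = Uᵀ * (Vᵀ * Ψ * V) * U := by
          rw [← hU]; simp only [Matrix.transpose_mul, Matrix.mul_assoc]
  have hdet : IsUnit (Wᵀ * Zᵀ * Ψ * Z * W).det := by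
    refine isUnit_det_of_forall_mulVec fun x hx => ?_
    rw [Matrix.mul_assoc _ Z W, ← Matrix.transpose_mul] at hx
    have hx0 := PosSemidef.mulVec_eq_zero_of_conj hΨ (Z * W) hx
    rw [← Matrix.mulVec_mulVec] at hx0
    have hZWx := hker _ (hΦZ (W *ᵥ x)) hx0 (hwZW x)
    exact hWinj (hZinj (by simpa using hZWx))
  refine ⟨fun v0 hv0 => ?_, hdet, ?_⟩
  · refine isUnit_det_of_forall_mulVec fun x hx => ?_
    obtain ⟨h1, h2⟩ := PosSemidef.mulVec_eq_zero_of_add (hVΦV.smul (inv_pos.mpr hv0).le)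
      (hVΨV.smul (inv_pos.mpr hv1).le) hx
    rw [Matrix.smul_mulVec, smul_eq_zero_iff_right (inv_pos.mpr hv0).ne'] at h1
    rw [Matrix.smul_mulVec, smul_eq_zero_iff_right (inv_pos.mpr hv1).ne'] at h2
    have hVx := hker _ (PosSemidef.mulVec_eq_zero_of_conj hΦ V h1)
      (PosSemidef.mulVec_eq_zero_of_conj hΨ V h2) (hwV x)
    exact hVinj (by simpa using hVx)
  · have hlim := tendsto_inv_smul_add_smul hVΦV.isHermitian U hkerU (hconj ▸ hdet) hv1.ne'
    have hcont : Continuous fun X : Matrix (Fin (p - 1)) (Fin (p - 1)) ℝ => V * X * Vᵀ := by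
      fun_prop
    have heq : v1 • (Z * W * (Wᵀ * Zᵀ * Ψ * Z * W)⁻¹ * (Z * W)ᵀ) =
        V * (v1 • (U * (Uᵀ * (Vᵀ * Ψ * V) * U)⁻¹ * Uᵀ)) * Vᵀ := by
      rw [hconj, ← hU]
      simp only [Matrix.transpose_mul, Matrix.mul_assoc, Matrix.smul_mul, Matrix.mul_smul]
    rw [heq]
    exact (hcont.tendsto _).comp hlim
end
end

section
/- Let L ∈ ℝ^{p×p} be symmetric and let V ∈ ℝ^{p×r} satisfy VᵀV = I_r. If VᵀLV is invertible, then the product of the nonzero eigenvalues of the symmetric matrix VVᵀLVVᵀ, counted with multiplicity, equals det(VᵀLV). -/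
open Matrix BigOperators Finset

noncomputable section

/-- The nonzero eigenvalues of `A * B`, when it is Hermitian, are the nonzero roots of the
characteristic polynomial of `B * A`. -/
theorem prod_nonzero_eigenvalues_mul {m n : Type*} [Fintype m] [DecidableEq m] [Fintype n]
    [DecidableEq n] (A : Matrix m n ℝ) (B : Matrix n m ℝ) (hAB : (A * B).IsHermitian) :
    ∏ i ∈ Finset.univ.filter (fun i => hAB.eigenvalues i ≠ 0), hAB.eigenvalues i
      = ((B * A).charpoly.roots.filter (· ≠ 0)).prod := by
  have key := congrArg (fun q : Polynomial ℝ => q.roots.filter (· ≠ 0))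
    (Matrix.charpoly_mul_comm' A B)
  have hX : ∀ (k : ℕ) (q : Polynomial ℝ), q.Monic →
      (Polynomial.X ^ k * q).roots.filter (· ≠ 0) = q.roots.filter (· ≠ 0) := by
    intro k q hq
    rw [Polynomial.roots_mul ((Polynomial.monic_X_pow k).mul hq).ne_zero,
      Polynomial.roots_X_pow, Multiset.filter_add, Multiset.filter_eq_nil.2, zero_add]
    intro a ha
    simp [Multiset.mem_singleton.1 (Multiset.mem_of_mem_nsmul ha)]
  simp only [hX _ _ (Matrix.charpoly_monic _)] at key
  rw [← key, hAB.roots_charpoly_eq_eigenvalues, Multiset.filter_map]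
  rfl

/-- for symmetric `L` and `V` with orthonormal columns such that
`VᵀLV` is invertible, the product of the nonzero eigenvalues (with multiplicity)
of the symmetric matrix `VVᵀLVVᵀ` equals `det(VᵀLV)`. -/
theorem statement_17 {p r : ℕ}
    (L : Matrix (Fin p) (Fin p) ℝ) (hL : L.IsHermitian)
    (V : Matrix (Fin p) (Fin r) ℝ) (hV : Vᵀ * V = 1)
    (hdet : IsUnit (Vᵀ * L * V).det)
    (hM : (V * Vᵀ * L * V * Vᵀ).IsHermitian) :
    (∏ i ∈ Finset.univ.filter (fun i => hM.eigenvalues i ≠ 0), hM.eigenvalues i)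
      = (Vᵀ * L * V).det := by
  have hB : (Vᵀ * L * V).IsHermitian := by
    simpa using Matrix.isHermitian_conjTranspose_mul_mul V hL
  have hfac : V * Vᵀ * L * V * Vᵀ = V * (Vᵀ * L * V * Vᵀ) := by
    simp only [Matrix.mul_assoc]
  have hcomm : Vᵀ * L * V * Vᵀ * V = Vᵀ * L * V := by
    rw [Matrix.mul_assoc _ Vᵀ V, hV, Matrix.mul_one]
  have hprod : (Vᵀ * L * V).det = (Vᵀ * L * V).charpoly.roots.prod :=
    Matrix.det_eq_prod_roots_charpoly_of_splits hB.splits_charpoly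
  have hroots : (Vᵀ * L * V).charpoly.roots.filter (· ≠ 0) = (Vᵀ * L * V).charpoly.roots := by
    refine Multiset.filter_eq_self.2 fun a ha h0 => hdet.ne_zero ?_
    rw [hprod]
    exact Multiset.prod_eq_zero (h0 ▸ ha)
  simp only [hfac]
  rw [prod_nonzero_eigenvalues_mul V (Vᵀ * L * V * Vᵀ) (hfac ▸ hM), hcomm, hroots, hprod]
end
end

section
/- (Contraction identity behind Proposition 4.) Let n, k ≥ 1 and let γ ∈ {0,1}^{n×k} satisfy Σ_{j=1}^k γ_{ij} = 1 for every i ∈ {1,…,n}. Let L ∈ ℝ^{(n+k)×(n+k)} be the weighted Laplacian of the complete bipartite graph between {1,…,n} and {n+1,…,n+k}, where the edge joining i and n+j has weight 1 − γ_{ij}; that is, for u ∈ ℝ^{n+k}, uᵀLu = Σ_{i=1}^n Σ_{j=1}^k (1 − γ_{ij})(u_i − u_{n+j})². Let Z ∈ ℝ^{(n+k)×k} be the block matrix stacking γ on top of I_k. Then for every μ ∈ ℝ^k, μᵀ Zᵀ L Z μ = Σ_{1 ≤ j < l ≤ k} (n_j + n_l)(μ_j − μ_l)², where n_j = Σ_{i=1}^n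 γ_{ij} is the size of the j-th cluster. -/
open Matrix BigOperators Finset
open scoped Classical

noncomputable section

/-- A double sum over a linear order of a function vanishing on the diagonal,
folded onto the strictly increasing pairs. -/
theorem sum_sum_eq_sum_lt_add_swap {ι M : Type*} [Fintype ι] [LinearOrder ι] [AddCommMonoid M]
    (g : ι → ι → M) (hg : ∀ a, g a a = 0) :
    ∑ a, ∑ b, g a b
      = ∑ q ∈ Finset.univ.filter (fun q : ι × ι => q.1 < q.2), (g q.1 q.2 + g q.2 q.1) := by
  have hswap : ∑ q ∈ Finset.univ.filter (fun q : ι × ι => q.1 < q.2), g q.2 q.1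
      = ∑ q ∈ Finset.univ.filter (fun q : ι × ι => q.2 < q.1), g q.1 q.2 :=
    Finset.sum_nbij' Prod.swap Prod.swap (by simp) (by simp) (by simp) (by simp) (by simp)
  rw [Finset.sum_add_distrib, hswap, Finset.sum_filter, Finset.sum_filter,
    ← Finset.sum_add_distrib, ← Fintype.sum_prod_type']
  refine Finset.sum_congr rfl fun q _ => ?_
  rcases lt_trichotomy q.1 q.2 with h | h | h
  · simp [h, h.not_gt]
  · simp [h, hg]
  · simp [h, h.not_gt]

/-- A `0`-`1` vector with sum one is an indicator of a single index. -/
theorem exists_eq_ite_of_sum_eq_one {ι : Type*} [Fintype ι] [DecidableEq ι] (v : ι → ℝ)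
    (hv : ∀ j, v j = 0 ∨ v j = 1) (hsum : ∑ j, v j = 1) :
    ∃ c, ∀ j, v j = if j = c then 1 else 0 := by
  have hnonneg : ∀ j, 0 ≤ v j := fun j => by rcases hv j with h | h <;> simp [h]
  obtain ⟨c, hc⟩ : ∃ c, v c = 1 := by
    by_contra! h
    have hzero : ∀ j, v j = 0 := fun j => (hv j).resolve_right (h j)
    simp [hzero] at hsum
  refine ⟨c, fun j => ?_⟩
  split_ifs with h
  · rw [h, hc]
  · have hle : ∑ x ∈ {j, c}, v x ≤ ∑ x, v x :=
      Finset.sum_le_sum_of_subset_of_nonneg (Finset.subset_univ _) fun x _ _ => hnonneg x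
    rw [Finset.sum_pair h, hsum, hc] at hle
    linarith [hnonneg j]

/-- For a `0`-`1` vector `v` with sum one, the weight `1 - v j` may be dropped and
the selected value pulled out of the square. -/
theorem one_sub_mul_sq_sub_eq_sum {ι : Type*} [Fintype ι] [DecidableEq ι] (v μ : ι → ℝ)
    (hv : ∀ j, v j = 0 ∨ v j = 1) (hsum : ∑ j, v j = 1) (j : ι) :
    (1 - v j) * (∑ l, v l * μ l - μ j) ^ 2 = ∑ l, v l * (μ l - μ j) ^ 2 := by
  obtain ⟨c, hc⟩ := exists_eq_ite_of_sum_eq_one v hv hsum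
  by_cases h : j = c <;> simp [hc, h]

/-- contraction identity behind Proposition 4: let
`γ ∈ {0,1}^{n×k}` have unit row sums, let `L` be the weighted Laplacian of the
complete bipartite graph between `{1,…,n}` and `{n+1,…,n+k}` with the edge
joining `i` and `n+j` weighted by `1 − γ_{ij}`, and let `Z = [γ; I_k]`.  Then
`μᵀ Zᵀ L Z μ = ∑_{j<l} (n_j + n_l)(μ_j − μ_l)²`, where `n_j = ∑_i γ_{ij}`. -/
theorem statement_19 {n k : ℕ} (hn : 1 ≤ n) (hk : 1 ≤ k)
    (γ : Fin n → Fin k → ℝ)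
    (hγ01 : ∀ i j, γ i j = 0 ∨ γ i j = 1)
    (hγrow : ∀ i, ∑ j, γ i j = 1)
    (L : Matrix (Fin (n + k)) (Fin (n + k)) ℝ) (hLsym : L.IsSymm)
    (hLquad : ∀ u : Fin (n + k) → ℝ,
      u ⬝ᵥ L.mulVec u = ∑ i : Fin n, ∑ j : Fin k,
        (1 - γ i j) * (u (Fin.castAdd k i) - u (Fin.natAdd n j)) ^ 2)
    (Z : Matrix (Fin (n + k)) (Fin k) ℝ)
    (hZtop : ∀ (i : Fin n) (j : Fin k), Z (Fin.castAdd k i) j = γ i j)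
    (hZbot : ∀ (j' j : Fin k), Z (Fin.natAdd n j') j = if j' = j then 1 else 0) :
    ∀ μ : Fin k → ℝ,
      μ ⬝ᵥ (Zᵀ * L * Z).mulVec μ
        = ∑ q ∈ Finset.univ.filter (fun q : Fin k × Fin k => q.1 < q.2),
            ((∑ i, γ i q.1) + (∑ i, γ i q.2)) * (μ q.1 - μ q.2) ^ 2 := by
  intro μ
  have hquad : μ ⬝ᵥ (Zᵀ * L * Z).mulVec μ = (Z *ᵥ μ) ⬝ᵥ L *ᵥ (Z *ᵥ μ) := by
    rw [← Matrix.mulVec_mulVec, ← Matrix.mulVec_mulVec, Matrix.dotProduct_mulVec,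
      Matrix.vecMul_transpose]
  have htop : ∀ i, (Z *ᵥ μ) (Fin.castAdd k i) = ∑ l, γ i l * μ l := fun i => by
    simp [Matrix.mulVec, dotProduct, hZtop]
  have hbot : ∀ j, (Z *ᵥ μ) (Fin.natAdd n j) = μ j := fun j => by
    simp [Matrix.mulVec, dotProduct, hZbot]
  calc μ ⬝ᵥ (Zᵀ * L * Z).mulVec μ
      = ∑ i, ∑ j, ∑ l, γ i l * (μ l - μ j) ^ 2 := by
        rw [hquad, hLquad]
        simp only [htop, hbot]
        exact Finset.sum_congr rfl fun i _ => Finset.sum_congr rfl fun j _ =>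
          one_sub_mul_sq_sub_eq_sum (γ i) μ (hγ01 i) (hγrow i) j
    _ = ∑ j, ∑ l, (∑ i, γ i l) * (μ l - μ j) ^ 2 := by
        rw [Finset.sum_comm]
        refine Finset.sum_congr rfl fun j _ => ?_
        rw [Finset.sum_comm]
        simp only [Finset.sum_mul]
    _ = _ := by
        rw [sum_sum_eq_sum_lt_add_swap _ (by simp)]
        refine Finset.sum_congr (by ext; simp) fun q _ => ?_
        ring
end
end
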